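/- Let G be an almost torsion-free word-hyperbolic group which is locally quasiconvex, i.e. every finitely generated subgroup of G is quasiconvex. Then for every integer l ≥ 1 the group G has only finitely many conjugacy classes of non-elementary freely indecomposable l-generated subgroups; that is, there exist finitely many subgroups H₁,…,H_N of G such that every non-elementary, freely indecomposable subgroup of G generated by at most l elements is conjugate in G to some H_i. -/

import Mathlib

noncomputable section

namespace KW

open Metric Set Pointwise

variable {X : Type*} [MetricSpace X]

/-- `s` is (the image of) a unit-speed geodesic segment joining `x` to `y`. -/
def IsGeodesicSegment (s : Set X) (x y : X) : Prop :=
  ∃ (b : ℝ) (f : ℝ → X), 0 ≤ b ∧ f 0 = x ∧ f b = y ∧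
    (∀ u ∈ Set.Icc (0 : ℝ) b, ∀ v ∈ Set.Icc (0 : ℝ) b, dist (f u) (f v) = |u - v|) ∧
    s = f '' Set.Icc 0 b

/-- A geodesic metric space. -/
def GeodesicSpace (X : Type*) [MetricSpace X] : Prop :=
  ∀ x y : X, ∃ s : Set X, IsGeodesicSegment s x y

/-- `X` is `δ`-hyperbolic: geodesic, and every geodesic triangle is `δ`-thin. -/
def DeltaHyperbolic (δ : ℝ) (X : Type*) [MetricSpace X] : Prop :=
  GeodesicSpace X ∧
    ∀ (x y z : X) (s₁ s₂ s₃ : Set X),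
      IsGeodesicSegment s₁ x y → IsGeodesicSegment s₂ y z → IsGeodesicSegment s₃ x z →
      ∀ p ∈ s₁, ∃ q ∈ s₂ ∪ s₃, dist p q ≤ δ

/-- `A` is an `ε`-quasiconvex subset of `X`. -/
def Quasiconvex (ε : ℝ) (A : Set X) : Prop :=
  ∀ x ∈ A, ∀ y ∈ A, ∀ s : Set X, IsGeodesicSegment s x y → ∀ p ∈ s, ∃ a ∈ A, dist p a ≤ ε

/-- The Gromov product `(y,z)_x`. -/
def gromov (x y z : X) : ℝ := (dist y x + dist z x - dist y z) / 2

def IsGeodesicRay (γ : ℝ → X) : Prop :=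
  ∀ s t : ℝ, 0 ≤ s → 0 ≤ t → dist (γ s) (γ t) = |s - t|

def IsBiGeodesic (γ : ℝ → X) : Prop :=
  ∀ s t : ℝ, dist (γ s) (γ t) = |s - t|

/-- `A` and `B` are `K`-Hausdorff close. -/
def HClose (K : ℝ) (A B : Set X) : Prop :=
  (∀ a ∈ A, ∃ b ∈ B, dist a b ≤ K) ∧ ∀ b ∈ B, ∃ a ∈ A, dist a b ≤ K

def HausdorffClose (A B : Set X) : Prop := ∃ K : ℝ, HClose K A B

/-- Two geodesic rays are asymptotic iff their images are Hausdorff close. -/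
def Asymptotic (γ γ' : ℝ → X) : Prop :=
  HausdorffClose (γ '' Set.Ici 0) (γ' '' Set.Ici 0)

def GRay (X : Type*) [MetricSpace X] : Type _ := {γ : ℝ → X // IsGeodesicRay γ}

theorem asymptotic_refl (γ : ℝ → X) : Asymptotic γ γ :=
  ⟨0, fun a ha => ⟨a, ha, by simp⟩, fun b hb => ⟨b, hb, by simp⟩⟩

theorem asymptotic_symm {γ γ' : ℝ → X} (h : Asymptotic γ γ') : Asymptotic γ' γ := by
  obtain ⟨K, h₁, h₂⟩ := h
  refine ⟨K, fun a ha => ?_, fun b hb => ?_⟩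
  · obtain ⟨b, hb, hd⟩ := h₂ a ha
    exact ⟨b, hb, by rwa [dist_comm]⟩
  · obtain ⟨a, ha, hd⟩ := h₁ b hb
    exact ⟨a, ha, by rwa [dist_comm]⟩

theorem asymptotic_trans {γ₁ γ₂ γ₃ : ℝ → X} (h : Asymptotic γ₁ γ₂)
    (h' : Asymptotic γ₂ γ₃) : Asymptotic γ₁ γ₃ := by
  obtain ⟨K, h₁, h₂⟩ := h
  obtain ⟨K', h₁', h₂'⟩ := h'
  refine ⟨K + K', fun a ha => ?_, fun c hc => ?_⟩
  · obtain ⟨b, hb, hab⟩ := h₁ a ha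
    obtain ⟨c, hc, hbc⟩ := h₁' b hb
    exact ⟨c, hc, (dist_triangle a b c).trans (by linarith)⟩
  · obtain ⟨b, hb, hbc⟩ := h₂' c hc
    obtain ⟨a, ha, hab⟩ := h₂ b hb
    exact ⟨a, ha, (dist_triangle a b c).trans (by linarith)⟩

def raySetoid (X : Type*) [MetricSpace X] : Setoid (GRay X) where
  r γ γ' := Asymptotic γ.1 γ'.1
  iseqv := ⟨fun γ => asymptotic_refl γ.1, fun h => asymptotic_symm h,
    fun h h' => asymptotic_trans h h'⟩

/-- The (geodesic) boundary of `X`: asymptoty classes of geodesic rays. -/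
def Boundary (X : Type*) [MetricSpace X] : Type _ := Quotient (raySetoid X)

def Boundary.mk {X : Type*} [MetricSpace X] (γ : GRay X) : Boundary X :=
  Quotient.mk (raySetoid X) γ

/-- A strongly geodesic metric space. -/
def StronglyGeodesic (X : Type*) [MetricSpace X] : Prop :=
  GeodesicSpace X ∧
  (∀ γ : ℝ → X, IsGeodesicRay γ → ∀ y : X,
      ∃ γ' : ℝ → X, IsGeodesicRay γ' ∧ γ' 0 = y ∧ Asymptotic γ γ') ∧
  (∀ γ₁ γ₂ : ℝ → X, IsGeodesicRay γ₁ → IsGeodesicRay γ₂ → γ₁ 0 = γ₂ 0 →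
      ¬ Asymptotic γ₁ γ₂ →
      ∃ γ : ℝ → X, IsBiGeodesic γ ∧
        HausdorffClose (Set.range γ) (γ₁ '' Set.Ici 0 ∪ γ₂ '' Set.Ici 0)) ∧
  (∀ (x : X) (u : ℕ → X),
      (∀ M : ℝ, ∃ N : ℕ, ∀ n, N ≤ n → ∀ m, N ≤ m → M ≤ gromov x (u n) (u m)) →
      ∃ γ : ℝ → X, IsGeodesicRay γ ∧ γ 0 = x ∧
        ∀ M : ℝ, ∃ N : ℕ, ∀ n, N ≤ n → ∀ m, N ≤ m → M ≤ gromov x (γ (n : ℝ)) (u m))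

/-- The sequence `u` converges to the boundary point `p`, with basepoint `x`. -/
def SeqConvTo (x : X) (u : ℕ → X) (p : Boundary X) : Prop :=
  ∃ γ : GRay X, Boundary.mk γ = p ∧
    ∀ M : ℝ, ∃ N : ℕ, ∀ n, N ≤ n → ∀ m, N ≤ m → M ≤ gromov x (u n) (γ.1 (m : ℝ))

/-- `γ` is a geodesic ray in the class of the boundary point `p`. -/
def RayTo (γ : ℝ → X) (p : Boundary X) : Prop :=
  ∃ h : IsGeodesicRay γ, Boundary.mk ⟨γ, h⟩ = p

/-- `γ` is a biinfinite geodesic whose two ends converge to `p` and `q`. -/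
def BiGeodesicJoins (γ : ℝ → X) (p q : Boundary X) : Prop :=
  IsBiGeodesic γ ∧ SeqConvTo (γ 0) (fun n => γ (-(n : ℝ))) p ∧
    SeqConvTo (γ 0) (fun n => γ (n : ℝ)) q

/-- `s` is (the image of) a geodesic joining two points of `X ∪ ∂X`. -/
def JoinSet : X ⊕ Boundary X → X ⊕ Boundary X → Set X → Prop
  | Sum.inl x, Sum.inl y, s => IsGeodesicSegment s x y
  | Sum.inl x, Sum.inr p, s => ∃ γ : ℝ → X, γ 0 = x ∧ RayTo γ p ∧ s = γ '' Set.Ici 0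
  | Sum.inr p, Sum.inl x, s => ∃ γ : ℝ → X, γ 0 = x ∧ RayTo γ p ∧ s = γ '' Set.Ici 0
  | Sum.inr p, Sum.inr q, s => ∃ γ : ℝ → X, BiGeodesicJoins γ p q ∧ s = Set.range γ

/-- The convex hull `Conv(A)` of a subset `A ⊆ X ∪ ∂X`. -/
def geoConv (A : Set (X ⊕ Boundary X)) : Set X :=
  {x | (∃ a : X, A = {Sum.inl a} ∧ x = a) ∨
    ∃ p ∈ A, ∃ q ∈ A, p ≠ q ∧ ∃ s : Set X, JoinSet p q s ∧ x ∈ s}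

/-- The distance between two subsets of `X`. -/
def setDist (A B : Set X) : ℝ := sInf (Set.image2 dist A B)

/-- `a` is a projection of `p` on `A` (relative to `δ`). -/
def IsProjection (δ : ℝ) (A : Set X) (p a : X) : Prop :=
  a ∈ A ∧ ∀ a' ∈ A, dist p a ≤ dist p a' + δ

/-- `f` restricted to `[0,L]` is a unit-speed geodesic from `x` to `y`. -/
def GeodParam (f : ℝ → X) (L : ℝ) (x y : X) : Prop :=
  0 ≤ L ∧ f 0 = x ∧ f L = y ∧
    ∀ u ∈ Set.Icc (0 : ℝ) L, ∀ v ∈ Set.Icc (0 : ℝ) L, dist (f u) (f v) = |u - v|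

/-- Concatenation of three paths, the first on `[0,a]`, the second on `[0,b]`. -/
def concat3 (f₁ f₂ f₃ : ℝ → X) (a b : ℝ) : ℝ → X := fun t =>
  if t ≤ a then f₁ t else if t ≤ a + b then f₂ (t - a) else f₃ (t - a - b)

/-- `f` is a `(lam, ε)`-quasigeodesic on `[a,b]`. -/
def QuasigeodesicOn (lam ε : ℝ) (f : ℝ → X) (a b : ℝ) : Prop :=
  ∀ s ∈ Set.Icc a b, ∀ t ∈ Set.Icc a b, |s - t| ≤ lam * dist (f s) (f t) + ε

/-- The action of `G` on `X` is by isometries. -/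
def IsometricAction (G Y : Type*) [Group G] [MetricSpace Y] [MulAction G Y] : Prop :=
  ∀ (g : G) (x y : Y), dist (g • x) (g • y) = dist x y

section GroupAction

variable {G : Type*} [Group G]

/-- The limit set `Λ(U) ⊆ ∂X` of a subgroup `U ≤ G`. -/
def limitSet (X : Type*) [MetricSpace X] [MulAction G X] (U : Subgroup G) :
    Set (Boundary X) :=
  {p | ∃ x₀ : X, ∃ u : ℕ → U, SeqConvTo x₀ (fun n => ((u n : G)) • x₀) p}

/-- The small displacement set `E(U)` (relative to `δ`). -/
def smallDispSet (X : Type*) [MetricSpace X] [MulAction G X] (δ : ℝ) (U : Subgroup G) :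
    Set X :=
  {x | ∃ u : G, u ∈ U ∧ u ≠ 1 ∧ dist x (u • x) ≤ 100 * δ}

/-- `Z(U) = Conv(Λ(U) ∪ E(U))`. -/
def ZSet (X : Type*) [MetricSpace X] [MulAction G X] (δ : ℝ) (U : Subgroup G) : Set X :=
  geoConv (Sum.inr '' limitSet X U ∪ Sum.inl '' smallDispSet X δ U)

/-- The convex hull `X(U)`: the closure of `Conv(Z(U))`. -/
def cHull (X : Type*) [MetricSpace X] [MulAction G X] (δ : ℝ) (U : Subgroup G) : Set X :=
  closure (geoConv (Sum.inl '' ZSet X δ U))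

/-- The weak convex hull `X_U = Conv(Λ(U))`. -/
def weakHull (X : Type*) [MetricSpace X] [MulAction G X] (U : Subgroup G) : Set X :=
  geoConv (Sum.inr '' limitSet X U)

/-- `l_V(g) = d(X(V), gX(V))`. -/
def lV (X : Type*) [MetricSpace X] [MulAction G X] (δ : ℝ) (V : Subgroup G) (g : G) : ℝ :=
  setDist (cHull X δ V) (g • cHull X δ V)

/-- The translation length of `g`. -/
def translationLength (X : Type*) [MetricSpace X] [MulAction G X] (g : G) : ℝ :=
  sInf (Set.range fun x : X => dist x (g • x))

/-- The asymptotic translation length of `g`. -/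
def asympTranslationLength (X : Type*) [MetricSpace X] [MulAction G X] (g : G) : ℝ :=
  Filter.liminf (fun n : ℕ => translationLength X (g ^ n) / (n : ℝ)) Filter.atTop

/-- An elementary move between `G`-tuples `(U₁,…,U_n; h₁,…,h_m)`. -/
def gMove {n m : ℕ} (M M' : (Fin n → Subgroup G) × (Fin m → G)) : Prop :=
  (M'.2 = M.2 ∧ ∃ (j : Fin n) (g : G),
      g ∈ Subgroup.closure (Set.range M.2 ∪ ⋃ i ∈ {i : Fin n | i ≠ j}, ((M.1 i : Set G))) ∧
      (∀ i, i ≠ j → M'.1 i = M.1 i) ∧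
      M'.1 j = Subgroup.map (MulAut.conj g).toMonoidHom (M.1 j)) ∨
  (M'.1 = M.1 ∧ ∃ (i : Fin m) (g₁ g₂ : G),
      g₁ ∈ Subgroup.closure (M.2 '' {j : Fin m | j ≠ i} ∪ ⋃ t, ((M.1 t : Set G))) ∧
      g₂ ∈ Subgroup.closure (M.2 '' {j : Fin m | j ≠ i} ∪ ⋃ t, ((M.1 t : Set G))) ∧
      (∀ j, j ≠ i → M'.2 j = M.2 j) ∧
      M'.2 i = g₁ * M.2 i * g₂)

/-- Equivalence of `G`-tuples: a finite chain of elementary moves. -/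
def gEquiv {n m : ℕ} :
    (Fin n → Subgroup G) × (Fin m → G) → (Fin n → Subgroup G) × (Fin m → G) → Prop :=
  Relation.ReflTransGen gMove

/-- The family of factors `U₁,…,U_n, F(h₁),…,F(h_m)`. -/
def FF {n : ℕ} (m : ℕ) (U : Fin n → Subgroup G) : Fin n ⊕ Fin m → Type _
  | Sum.inl j => ↥(U j)
  | Sum.inr _ => FreeGroup PUnit

instance ffGroup {n : ℕ} (m : ℕ) (U : Fin n → Subgroup G) :
    (i : Fin n ⊕ Fin m) → Group (FF m U i)
  | Sum.inl j => inferInstanceAs (Group ↥(U j))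
  | Sum.inr _ => inferInstanceAs (Group (FreeGroup PUnit))

def ffHoms {n m : ℕ} (U : Fin n → Subgroup G) (H : Fin m → G) :
    (i : Fin n ⊕ Fin m) → FF m U i →* G
  | Sum.inl j => (U j).subtype
  | Sum.inr j => FreeGroup.lift fun _ => H j

/-- The canonical homomorphism `U₁ ∗ ⋯ ∗ U_n ∗ F(H) → G`. -/
def freeProdHom {n m : ℕ} (U : Fin n → Subgroup G) (H : Fin m → G) :
    Monoid.CoprodI (FF m U) →* G :=
  Monoid.CoprodI.lift (ffHoms U H)

/-- `W = U₁ ∗ ⋯ ∗ U_n ∗ F(H)`: the canonical homomorphism is injective with image `W`. -/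
def IsFreeProdDecomp {n m : ℕ} (U : Fin n → Subgroup G) (H : Fin m → G)
    (W : Subgroup G) : Prop :=
  Function.Injective (freeProdHom U H) ∧ (freeProdHom U H).range = W

/-- Minimality of the `G`-pair `(V; H)` (relative to a `1`-hyperbolic `G`-space `X`). -/
def PairMinimal (X : Type*) [MetricSpace X] [MulAction G X] {m : ℕ}
    (V : Subgroup G) (H : Fin m → G) : Prop :=
  ∀ (V' : Subgroup G) (H' : Fin m → G),
    gEquiv ((fun _ : Fin 1 => V), H) ((fun _ : Fin 1 => V'), H') →
    (∑ i, lV X 1 V (H i)) ≤ (∑ i, lV X 1 V' (H' i)) + 1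

/-- An elementary Nielsen move on tuples of elements of `G`. -/
def NielsenMove {k : ℕ} (g g' : Fin k → G) : Prop :=
  (∃ i : Fin k, (∀ j, j ≠ i → g' j = g j) ∧ g' i = (g i)⁻¹) ∨
  (∃ i j : Fin k, i ≠ j ∧ (∀ t, t ≠ i → g' t = g t) ∧ g' i = g i * g j) ∨
  (∃ i j : Fin k, i ≠ j ∧ g' = g ∘ Equiv.swap i j)

/-- Nielsen equivalence: a finite chain of elementary Nielsen moves. -/
def NielsenEq {k : ℕ} : (Fin k → G) → (Fin k → G) → Prop :=
  Relation.ReflTransGen NielsenMove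

/-- Word length of `g` with respect to the (symmetrized) generating set `S`. -/
def wordLength (S : Set G) (g : G) : ℕ :=
  sInf {n : ℕ | ∃ f : Fin n → G, (∀ i, f i ∈ S ∨ (f i)⁻¹ ∈ S) ∧ (List.ofFn f).prod = g}

/-- `(X, ι)` is a model of the Cayley graph `Γ(G,S)`. -/
def IsCayleyGraph (G : Type*) [Group G] (S : Set G) (X : Type*) [MetricSpace X]
    [MulAction G X] (ι : G → X) : Prop :=
  IsometricAction G X ∧
  (∀ g h : G, ι (g * h) = g • ι h) ∧
  Function.Injective ι ∧
  GeodesicSpace X ∧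
  (∀ g h : G, dist (ι g) (ι h) = (wordLength S (g⁻¹ * h) : ℝ)) ∧
  ∀ x : X, ∃ g h : G, wordLength S (g⁻¹ * h) ≤ 1 ∧
    ∃ s : Set X, IsGeodesicSegment s (ι g) (ι h) ∧ x ∈ s

/-- `H` is a quasiconvex subgroup (with respect to the Cayley graph model `(X, ι)`). -/
def QCSubgroup (X : Type*) [MetricSpace X] (ι : G → X) (H : Subgroup G) : Prop :=
  ∃ ε : ℝ, 0 ≤ ε ∧ Quasiconvex ε (ι '' (H : Set G))

end GroupAction

/-- Every nontrivial element of finite order has finite centralizer. -/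
def AlmostTorsionFree (G : Type*) [Group G] : Prop :=
  ∀ g : G, g ≠ 1 → IsOfFinOrder g → ((Subgroup.centralizer {g} : Subgroup G) : Set G).Finite

/-- `U` is nontrivial and admits no nontrivial free product decomposition. -/
def FreelyIndecomposable (U : Type*) [Group U] : Prop :=
  Nontrivial U ∧
    ¬ ∃ A B : Subgroup U, A ≠ ⊥ ∧ B ≠ ⊥ ∧
        Function.Bijective (Monoid.Coprod.lift A.subtype B.subtype)

def InfiniteCyclic (U : Type*) [Group U] : Prop := Infinite U ∧ IsCyclic U

def VirtuallyCyclic (U : Type*) [Group U] : Prop :=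
  ∃ H : Subgroup U, H.index ≠ 0 ∧ IsCyclic ↥H

def NonElementary (U : Type*) [Group U] : Prop := ¬ Finite U ∧ ¬ VirtuallyCyclic U

end KW

namespace KWP

/-- Word-length-like function on a hyperbolic group. -/
structure HypLen {G : Type*} [Group G] (len : G → ℕ) (D : ℕ) : Prop where
  one : len 1 = 0
  inv : ∀ g, len g⁻¹ = len g
  mul : ∀ g h, len (g * h) ≤ len g + len h
  eq_one : ∀ g, len g = 0 → g = 1
  ball : ∀ n, {g | len g ≤ n}.Finite
  split : ∀ g t, t ≤ len g → ∃ a b, a * b = g ∧ len a = t ∧ len b + t = len g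
  four : ∀ x y z w : G,
    len (x⁻¹ * z) + len (y⁻¹ * w) ≤ len (x⁻¹ * y) + len (z⁻¹ * w) + D ∨
    len (x⁻¹ * z) + len (y⁻¹ * w) ≤ len (x⁻¹ * w) + len (y⁻¹ * z) + D

section Geo

variable {G : Type*} [Group G] {len : G → ℕ} {D : ℕ}

/-- distance -/
def ds (len : G → ℕ) (x y : G) : ℕ := len (x⁻¹ * y)

/-- `p` lies on a discrete geodesic from `x` to `y` -/
def On (len : G → ℕ) (x y p : G) : Prop := ds len x p + ds len p y = ds len x y

theorem ds_comm (H : HypLen len D) (x y : G) : ds len x y = ds len y x := by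
  unfold ds; rw [← H.inv]; simp

theorem ds_self (H : HypLen len D) (x : G) : ds len x x = 0 := by
  unfold ds; simp [H.one]

theorem ds_tri (H : HypLen len D) (x y z : G) : ds len x z ≤ ds len x y + ds len y z := by
  unfold ds
  have := H.mul (x⁻¹ * y) (y⁻¹ * z)
  simpa [mul_assoc] using this

theorem ds_left (g x y : G) : ds len (g * x) (g * y) = ds len x y := by
  unfold ds; simp [mul_assoc]

theorem ds_one (x : G) : ds len 1 x = len x := by simp [ds]

theorem ds_four (H : HypLen len D) (x y z w : G) :
    ds len x z + ds len y w ≤ ds len x y + ds len z w + D ∨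
    ds len x z + ds len y w ≤ ds len x w + ds len y z + D := H.four x y z w

theorem On.symm (H : HypLen len D) {x y p : G} (h : On len x y p) : On len y x p := by
  unfold On at *
  rw [ds_comm H y p, ds_comm H p x, ds_comm H y x]; omega

theorem exists_on (H : HypLen len D) (x y : G) (t : ℕ) (ht : t ≤ ds len x y) :
    ∃ p, On len x y p ∧ ds len x p = t := by
  obtain ⟨a, b, hab, ha, hb⟩ := H.split (x⁻¹ * y) t ht
  have e1 : ds len x (x * a) = len a := by simp [ds]
  have e2 : ds len (x * a) y = len b := by
    have : b = a⁻¹ * (x⁻¹ * y) := by rw [← hab]; group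
    simp [ds, this, mul_assoc]
  refine ⟨x * a, ?_, by omega⟩
  unfold On
  rw [e1, e2]
  unfold ds; omega

theorem thin1 (H : HypLen len D) (x y z p : G) (hp : On len x y p)
    (hs : 2 * ds len x p + ds len y z ≤ ds len x y + ds len x z) :
    ∃ q, On len x z q ∧ ds len x q = ds len x p ∧ ds len p q ≤ 2 * D := by
  unfold On at hp
  have t1 := ds_tri H x y z
  have t2 := ds_tri H x z y
  have t3 := ds_comm H z y
  obtain ⟨q, hq, hq'⟩ := exists_on H x z (ds len x p) (by omega)
  refine ⟨q, hq, hq', ?_⟩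
  unfold On at hq
  have c1 := ds_comm H p x
  have c2 := ds_comm H q x
  have c3 := ds_comm H z x
  have c4 := ds_comm H z q
  have c5 := ds_comm H y x
  have f1 := ds_four H p y z x
  have f2 := ds_four H p z q x
  omega

theorem thin (H : HypLen len D) (x y z p : G) (hp : On len x y p) :
    ∃ q, ds len p q ≤ 2 * D ∧ (On len x z q ∨ On len y z q) := by
  by_cases hs : 2 * ds len x p + ds len y z ≤ ds len x y + ds len x z
  · obtain ⟨q, h1, _, h2⟩ := thin1 H x y z p hp hs
    exact ⟨q, h2, Or.inl h1⟩
  · have hp' := hp.symm H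
    obtain ⟨q, h1, _, h2⟩ := thin1 H y x z p hp' (by
      unfold On at hp
      have c1 := ds_comm H y x
      have c2 := ds_comm H y p
      omega)
    exact ⟨q, h2, Or.inr h1⟩

theorem on_close (H : HypLen len D) (x y p q : G) (hp : On len x y p) (hq : On len x y q) :
    ds len p q + ds len x p ≤ ds len x q + D ∨ ds len p q + ds len x q ≤ ds len x p + D := by
  unfold On at hp hq
  have f := ds_four H x p y q
  have c1 := ds_comm H y q
  have c2 := ds_comm H p q
  have f := ds_four H p x q y
  have c3 := ds_comm H p x
  have c4 := ds_comm H q y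
  omega

/-- discrete quasiconvexity -/
def QC (len : G → ℕ) (ε : ℕ) (K : Subgroup G) : Prop :=
  ∀ x ∈ K, ∀ p, On len 1 x p → ∃ h ∈ K, ds len p h ≤ ε

/-- projection estimate -/
theorem proj_est (H : HypLen len D) {ε : ℕ} {K : Subgroup G} (hK : QC len ε K) (y : G)
    (hy : ∀ h ∈ K, len y ≤ ds len y h) (v : G) (hv : v ∈ K) :
    len y + len v ≤ ds len y v + 2 * (ε + 2 * D) + 2 := by
  by_contra hcon
  push Not at hcon
  have t1 := ds_tri H 1 y v
  have t2 := ds_tri H 1 v y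
  have c1 := ds_comm H v y
  rw [ds_one, ds_one] at t1 t2
  obtain ⟨p, hp, hp'⟩ := exists_on H 1 v (ε + 2 * D + 1) (by rw [ds_one]; omega)
  have e1 := ds_one (len := len) v
  have e2 := ds_one (len := len) y
  obtain ⟨q, hq, hq', hpq⟩ := thin1 H 1 v y p hp (by omega)
  obtain ⟨h, hh, hph⟩ := hK v hv p hp
  have := hy h hh
  have t3 := ds_tri H y q h
  have t4 := ds_tri H q p h
  unfold On at hq
  rw [ds_one y] at hq
  have c2 := ds_comm H y q
  have c3 := ds_comm H p q
  omega

theorem move_est (H : HypLen len D) {ε : ℕ} {K : Subgroup G} (hK : QC len ε K) (y : G)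
    (hy : ∀ h ∈ K, len y ≤ ds len y h) (v : G) (hv : v ∈ K)
    (hlong : 4 * (ε + 2 * D) + 5 + D ≤ len v) :
    2 * len y ≤ ds len y (v * y) + 4 * (ε + 2 * D) + 4 + D := by
  have h1 := proj_est H hK y hy v hv
  have h2 := proj_est H hK y hy v⁻¹ (K.inv_mem hv)
  have e1 : ds len y v⁻¹ = ds len 1 (v * y) := by
    rw [← ds_left v y v⁻¹, mul_inv_cancel, ds_comm H]
  have f := ds_four H y 1 v (v * y)
  have e2 : ds len v (v * y) = len y := by
    have := ds_left (len := len) v 1 y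
    rw [mul_one, ds_one] at this; exact this
  have e3 : ds len y 1 = len y := by rw [ds_comm H, ds_one]
  have e4 : ds len 1 v = len v := ds_one v
  have e5 := H.inv v
  rw [e1, e5] at h2
  omega

theorem exists_proj (len : G → ℕ) (K : Subgroup G) (x : G) :
    ∃ h ∈ K, ∀ h' ∈ K, ds len x h ≤ ds len x h' := by
  classical
  have hne : ∃ n, ∃ h ∈ K, ds len x h = n := ⟨_, 1, K.one_mem, rfl⟩
  obtain ⟨h, hh, he⟩ := Nat.find_spec hne
  refine ⟨h, hh, fun h' hh' => ?_⟩
  rw [he]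
  exact Nat.find_min' hne ⟨h', hh', rfl⟩

/-- elements moving a point a little -/
theorem elem_bound (H : HypLen len D)
    (hATF : ∀ g : G, g ≠ 1 → IsOfFinOrder g →
      ((Subgroup.centralizer {g} : Subgroup G) : Set G).Finite)
    {ε : ℕ} {K : Subgroup G} (hK : QC len ε K) (c : ℕ) (v : G) (hv : v ∈ K) (hv1 : v ≠ 1) :
    ∃ R, ∀ y, (∀ h ∈ K, len y ≤ ds len y h) → ds len y (v * y) ≤ c → len y ≤ R := by
  by_cases hfin : IsOfFinOrder v
  · have hfinset : {y : G | ds len y (v * y) ≤ c}.Finite := by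
      have hsub : {y : G | ds len y (v * y) ≤ c} ⊆
          ⋃ b ∈ {g | len g ≤ c}, {y | y⁻¹ * (v * y) = b} := by
        intro y hy
        simp only [Set.mem_iUnion, Set.mem_ofPred_eq]
        exact ⟨_, hy, rfl⟩
      refine (Set.Finite.biUnion (H.ball c) fun b _ => ?_).subset hsub
      rcases Set.eq_empty_or_nonempty {y : G | y⁻¹ * (v * y) = b} with h | ⟨y0, hy0⟩
      · rw [h]; exact Set.finite_empty
      · refine ((hATF v hv1 hfin).image (fun z => z * y0)).subset ?_
        intro y hy
        refine ⟨y * y0⁻¹, ?_, by simp⟩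
        simp only [Set.mem_ofPred_eq] at hy hy0
        rw [SetLike.mem_coe, Subgroup.mem_centralizer_singleton_iff]
        have h1 : v * y = y * b := by rw [← hy]; group
        have h2 : v * y0 = y0 * b := by rw [← hy0]; group
        have h3 : y0⁻¹ * v = b * y0⁻¹ := by
          rw [inv_mul_eq_iff_eq_mul, ← mul_assoc, ← h2]; group
        rw [mul_assoc, h3, ← mul_assoc, ← h1, mul_assoc]
    obtain ⟨R, hR⟩ := (hfinset.image len).bddAbove
    exact ⟨R, fun y _ hy => hR ⟨y, hy, rfl⟩⟩
  · set k := 4 * (ε + 2 * D) + 5 + D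
    have : ∃ n : ℕ, k ≤ len (v ^ n) := by
      by_contra hno
      push Not at hno
      have hinj : Function.Injective (fun n : ℕ => v ^ n) :=
        injective_pow_iff_not_isOfFinOrder.mpr hfin
      have : (Set.range (fun n : ℕ => v ^ n)).Finite :=
        (H.ball k).subset (by rintro _ ⟨n, rfl⟩; exact (hno n).le)
      exact Set.infinite_range_of_injective hinj this
    obtain ⟨n, hn⟩ := this
    refine ⟨n * c + k, fun y hy hd => ?_⟩
    have h1 := move_est H hK y hy (v ^ n) (K.pow_mem hv n) hn
    have h2 : ∀ m : ℕ, ds len y (v ^ m * y) ≤ m * c := by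
      intro m
      induction m with
      | zero => simp [ds_self H]
      | succ m ih =>
        have t := ds_tri H y (v ^ m * y) (v ^ (m + 1) * y)
        have : ds len (v ^ m * y) (v ^ (m + 1) * y) = ds len y (v * y) := by
          rw [pow_succ, mul_assoc, ds_left]
        rw [add_mul]; omega
    have := h2 n
    omega

theorem key (H : HypLen len D)
    (hATF : ∀ g : G, g ≠ 1 → IsOfFinOrder g →
      ((Subgroup.centralizer {g} : Subgroup G) : Set G).Finite)
    {ε : ℕ} {K : Subgroup G} (hK : QC len ε K) (c : ℕ) :
    ∃ R, ∀ x, ∀ u ∈ K, u ≠ 1 → ds len x (u * x) ≤ c → ∃ h ∈ K, ds len x h ≤ R := by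
  classical
  choose! Rf hRf using fun v (h : v ∈ K ∧ v ≠ 1) => elem_bound H hATF hK c v h.1 h.2
  obtain ⟨R0, hR0⟩ := ((H.ball (4 * (ε + 2 * D) + 5 + D)).image Rf).bddAbove
  refine ⟨R0 + c + 4 * (ε + 2 * D) + 4 + D, fun x u hu hu1 hd => ?_⟩
  obtain ⟨h, hh, hmin⟩ := exists_proj len K x
  refine ⟨h, hh, ?_⟩
  set y := h⁻¹ * x with hy
  have hlen : ds len x h = len y := by rw [ds_comm H]; rfl
  have hymin : ∀ h' ∈ K, len y ≤ ds len y h' := by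
    intro h' hh'
    have e1 := hmin (h * h') (K.mul_mem hh hh')
    have e2 : ds len x (h * h') = ds len y h' := by
      rw [← ds_left h y h', hy]; simp
    omega
  have hv : h⁻¹ * u * h ∈ K := K.mul_mem (K.mul_mem (K.inv_mem hh) hu) hh
  have hv1 : h⁻¹ * u * h ≠ 1 := by
    intro e; apply hu1
    have : u = h * (h⁻¹ * u * h) * h⁻¹ := by group
    rw [this, e]; group
  have hdy : ds len y (h⁻¹ * u * h * y) ≤ c := by
    have : ds len y (h⁻¹ * u * h * y) = ds len x (u * x) := by
      rw [← ds_left h y, hy]; congr 1 <;> group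
    omega
  by_cases hl : 4 * (ε + 2 * D) + 5 + D ≤ len (h⁻¹ * u * h)
  · have := move_est H hK y hymin _ hv hl
    omega
  · have h1 := hRf _ ⟨hv, hv1⟩ y hymin hdy
    have h2 := hR0 ⟨h⁻¹ * u * h, by simp only [Set.mem_ofPred_eq]; omega, rfl⟩
    omega

end Geo
end KWP

namespace KWP

noncomputable section Graph

open Classical

variable {G : Type*} [Group G]

/-- labelled arcs -/
abbrev Arc (G : Type*) := ℕ × ℕ × G

/-- labels of paths in a labelled graph -/
inductive Rch (E : Set (Arc G)) : ℕ → ℕ → G → Prop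
  | refl (i : ℕ) : Rch E i i 1
  | fwd {i j k : ℕ} {g a : G} : Rch E i j g → (j, k, a) ∈ E → Rch E i k (g * a)
  | bwd {i j k : ℕ} {g a : G} : Rch E i j g → (k, j, a) ∈ E → Rch E i k (g * a⁻¹)

theorem Rch.arc {E : Set (Arc G)} {i j : ℕ} {a : G} (h : (i, j, a) ∈ E) : Rch E i j a := by
  simpa using Rch.fwd (Rch.refl i) h

theorem Rch.rarc {E : Set (Arc G)} {i j : ℕ} {a : G} (h : (i, j, a) ∈ E) : Rch E j i a⁻¹ := by
  simpa using Rch.bwd (Rch.refl j) h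

theorem Rch.trans {E : Set (Arc G)} {i j k : ℕ} {a b : G} (h : Rch E i j a) (h' : Rch E j k b) :
    Rch E i k (a * b) := by
  induction h' with
  | refl => simpa using h
  | fwd _ hm ih => rw [← mul_assoc]; exact ih.fwd hm
  | bwd _ hm ih => rw [← mul_assoc]; exact ih.bwd hm

theorem Rch.symm {E : Set (Arc G)} {i j : ℕ} {a : G} (h : Rch E i j a) : Rch E j i a⁻¹ := by
  induction h with
  | refl => simpa using Rch.refl _
  | fwd _ hm ih => rw [mul_inv_rev]; exact (Rch.rarc hm).trans ih
  | bwd _ hm ih => rw [mul_inv_rev, inv_inv]; exact (Rch.arc hm).trans ih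

theorem Rch.cast {E : Set (Arc G)} {i j : ℕ} {a b : G} (h : Rch E i j a) (e : a = b) :
    Rch E i j b := e ▸ h

theorem Rch.map {E E' : Set (Arc G)} (r : ℕ → ℕ) (c : ℕ → G)
    (hm : ∀ i j a, (i, j, a) ∈ E → Rch E' (r i) (r j) (c i * a * (c j)⁻¹))
    {i j : ℕ} {a : G} (h : Rch E i j a) : Rch E' (r i) (r j) (c i * a * (c j)⁻¹) := by
  induction h with
  | refl => simpa using Rch.refl _
  | fwd _ h ih => exact (ih.trans (hm _ _ _ h)).cast (by group)
  | bwd _ h ih => exact (ih.trans (hm _ _ _ h).symm).cast (by group)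

theorem Rch.gen {E E' : Set (Arc G)} (hm : ∀ i j a, (i, j, a) ∈ E → Rch E' i j a)
    {i j : ℕ} {a : G} (h : Rch E i j a) : Rch E' i j a := by
  have := Rch.map (E' := E') id (fun _ => 1) (by intro i j a h; simpa using hm i j a h) h
  simpa using this

theorem Rch.mono {E E' : Set (Arc G)} (hm : E ⊆ E') {i j : ℕ} {a : G} (h : Rch E i j a) :
    Rch E' i j a := h.gen fun _ _ _ h => Rch.arc (hm h)

/-- vertex group -/
def vgrp (E : Set (Arc G)) (i : ℕ) : Subgroup G where
  carrier := {g | Rch E i i g}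
  one_mem' := Rch.refl i
  mul_mem' := fun h h' => Rch.trans h h'
  inv_mem' := fun h => Rch.symm h

theorem mem_vgrp {E : Set (Arc G)} {i : ℕ} {g : G} : g ∈ vgrp E i ↔ Rch E i i g := Iff.rfl

def rev (a : Arc G) : Arc G := (a.2.1, a.1, a.2.2⁻¹)

@[simp] theorem rev_rev (a : Arc G) : rev (rev a) = a := by simp [rev]

/-- oriented membership -/
def OE (E : Finset (Arc G)) (a : Arc G) : Prop := a ∈ E ∨ rev a ∈ E

theorem OE.rch {E : Finset (Arc G)} {a : Arc G} (h : OE E a) : Rch (E : Set (Arc G)) a.1 a.2.1 a.2.2 := by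
  rcases h with h | h
  · exact Rch.arc (by simpa using h)
  · have := (Rch.arc (E := (E : Set (Arc G))) (i := a.2.1) (j := a.1) (a := a.2.2⁻¹)
      (by simpa [rev] using h)).symm
    simpa using this

theorem OE.rev' {E : Finset (Arc G)} {a : Arc G} (h : OE E a) : OE E (rev a) := by
  rcases h with h | h
  · right; simpa using h
  · left; exact h

/-- delete an arc in both orientations -/
def del (E : Finset (Arc G)) (a : Arc G) : Finset (Arc G) := E.filter fun x => x ≠ a ∧ x ≠ rev a

theorem mem_del {E : Finset (Arc G)} {a x : Arc G} : x ∈ del E a ↔ x ∈ E ∧ x ≠ a ∧ x ≠ rev a := by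
  simp [del]

theorem del_sub (E : Finset (Arc G)) (a : Arc G) : (del E a : Set (Arc G)) ⊆ E := by
  intro x hx; exact (mem_del.1 (by simpa using hx)).1

variable (len : G → ℕ) in
def cost (E : Finset (Arc G)) : ℕ := ∑ a ∈ E, (len a.2.2 + 1)

variable {len : G → ℕ} {D : ℕ}

theorem cost_insert (x : Arc G) (E : Finset (Arc G)) :
    cost len (insert x E) ≤ cost len E + (len x.2.2 + 1) := by
  unfold cost
  by_cases h : x ∈ E
  · rw [Finset.insert_eq_of_mem h]; omega
  · rw [Finset.sum_insert h]; omega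

theorem cost_sub {x : Arc G} {E E' : Finset (Arc G)} (hE : E' ⊆ E) (hx : x ∈ E) (hx' : x ∉ E') :
    cost len E' + (len x.2.2 + 1) ≤ cost len E := by
  have : cost len (insert x E') ≤ cost len E :=
    Finset.sum_le_sum_of_subset (Finset.insert_subset hx hE)
  unfold cost at *
  rw [Finset.sum_insert hx'] at this
  omega

theorem card_sub {x : Arc G} {E E' : Finset (Arc G)} (hE : E' ⊆ E) (hx : x ∈ E) (hx' : x ∉ E') :
    E'.card + 1 ≤ E.card := by
  have := Finset.card_le_card (Finset.insert_subset hx hE)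
  rwa [Finset.card_insert_of_notMem hx'] at this

theorem cost_del (H : HypLen len D) {E : Finset (Arc G)} {a : Arc G} (h : OE E a) :
    cost len (del E a) + (len a.2.2 + 1) ≤ cost len E := by
  rcases h with h | h
  · exact cost_sub (Finset.filter_subset _ _) h (by simp [mem_del])
  · have := cost_sub (len := len) (E' := del E a) (Finset.filter_subset _ _) h (by simp [mem_del])
    simpa [rev, H.inv] using this

theorem card_del {E : Finset (Arc G)} {a : Arc G} (h : OE E a) :
    (del E a).card + 1 ≤ E.card := by
  rcases h with h | h
  · exact card_sub (Finset.filter_subset _ _) h (by simp [mem_del])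
  · exact card_sub (E' := del E a) (Finset.filter_subset _ _) h (by simp [mem_del])

/-- a labelled graph carrying (a conjugate of) `U` -/
structure Cfg (U : Subgroup G) (l : ℕ) (V : Finset ℕ) (E : Finset (Arc G)) : Prop where
  ends : ∀ a ∈ E, a.1 ∈ V ∧ a.2.1 ∈ V
  conn : ∀ i ∈ V, ∀ j ∈ V, ∃ g, Rch (E : Set (Arc G)) i j g
  card : E.card + 1 ≤ V.card + l
  grp : ∃ v ∈ V, ∃ c, ∀ g, Rch (E : Set (Arc G)) v v g ↔ c * g * c⁻¹ ∈ U

theorem Cfg.all {U : Subgroup G} {l : ℕ} {V : Finset ℕ} {E : Finset (Arc G)} (h : Cfg U l V E)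
    (v : ℕ) (hv : v ∈ V) : ∃ c, ∀ g, Rch (E : Set (Arc G)) v v g ↔ c * g * c⁻¹ ∈ U := by
  obtain ⟨w, hw, c, hc⟩ := h.grp
  obtain ⟨p, hp⟩ := h.conn w hw v hv
  refine ⟨c * p, fun g => ?_⟩
  have : c * p * g * (c * p)⁻¹ = c * (p * g * p⁻¹) * c⁻¹ := by group
  rw [this, ← hc]
  constructor
  · intro hg; exact (hp.trans hg).trans hp.symm
  · intro hg; exact ((hp.symm.trans hg).trans hp).cast (by group)

theorem OE.ends {U : Subgroup G} {l : ℕ} {V : Finset ℕ} {E : Finset (Arc G)} (h : Cfg U l V E)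
    {a : Arc G} (ha : OE E a) : a.1 ∈ V ∧ a.2.1 ∈ V := by
  rcases ha with ha | ha
  · exact h.ends _ ha
  · have := h.ends _ ha
    exact ⟨this.2, this.1⟩

theorem Cfg.same {U : Subgroup G} {l : ℕ} {V : Finset ℕ} {E E' : Finset (Arc G)} (h : Cfg U l V E)
    (he : ∀ a ∈ E', a.1 ∈ V ∧ a.2.1 ∈ V) (hc : E'.card ≤ E.card)
    (h1 : ∀ i j a, (i, j, a) ∈ E → Rch (E' : Set (Arc G)) i j a)
    (h2 : ∀ i j a, (i, j, a) ∈ E' → Rch (E : Set (Arc G)) i j a) : Cfg U l V E' := by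
  have k1 : ∀ {i j a}, Rch (E : Set (Arc G)) i j a → Rch (E' : Set (Arc G)) i j a :=
    fun hr => hr.gen (by simpa using h1)
  have k2 : ∀ {i j a}, Rch (E' : Set (Arc G)) i j a → Rch (E : Set (Arc G)) i j a :=
    fun hr => hr.gen (by simpa using h2)
  refine ⟨he, fun i hi j hj => ?_, ?_, ?_⟩
  · obtain ⟨g, hg⟩ := h.conn i hi j hj
    exact ⟨g, k1 hg⟩
  · have := h.card; omega
  · obtain ⟨v, hv, c, hc⟩ := h.grp
    exact ⟨v, hv, c, fun g => ⟨fun hg => (hc g).1 (k2 hg), fun hg => k1 ((hc g).2 hg)⟩⟩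

/-- deleted arcs are recovered once `a` is -/
theorem del_recover {E : Finset (Arc G)} {a : Arc G} {E' : Set (Arc G)}
    (hsub : (del E a : Set (Arc G)) ⊆ E') (ha : Rch E' a.1 a.2.1 a.2.2) :
    ∀ i j b, (i, j, b) ∈ E → Rch E' i j b := by
  intro i j b hb
  by_cases h1 : (i, j, b) = a
  · subst h1; exact ha
  · by_cases h2 : (i, j, b) = rev a
    · simp only [rev, Prod.mk.injEq] at h2
      obtain ⟨rfl, rfl, rfl⟩ := h2
      exact ha.symm
    · exact Rch.arc (hsub (by simpa using mem_del.2 ⟨hb, h1, h2⟩))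

theorem Cfg.rep {U : Subgroup G} {l : ℕ} {V : Finset ℕ} {E : Finset (Arc G)} (h : Cfg U l V E)
    {i j n : ℕ} {g w : G} (ha : OE E (i, j, g)) (hn : n ∈ V)
    (hw : Rch (del E (i, j, g) : Set (Arc G)) j n w) :
    Cfg U l V (insert (i, n, g * w) (del E (i, j, g))) := by
  apply h.same
  · intro a haa
    rcases Finset.mem_insert.1 haa with rfl | haa
    · exact ⟨(ha.ends h).1, hn⟩
    · exact h.ends _ (mem_del.1 haa).1
  · have := card_del ha
    have := Finset.card_insert_le (i, n, g * w) (del E (i, j, g))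
    omega
  · have hs : (del E (i, j, g) : Set (Arc G)) ⊆
        (insert (i, n, g * w) (del E (i, j, g)) : Finset (Arc G)) := by
      intro x hx; simp at hx ⊢; exact Or.inr hx
    apply del_recover hs
    have h1 : Rch ((insert (i, n, g * w) (del E (i, j, g)) : Finset (Arc G)) : Set (Arc G))
        i n (g * w) := Rch.arc (by simp)
    exact (h1.trans (hw.mono hs).symm).cast (by group)
  · intro x y b hb
    rcases Finset.mem_insert.1 hb with hb | hb
    · simp only [Prod.mk.injEq] at hb
      obtain ⟨rfl, rfl, rfl⟩ := hb
      exact ha.rch.trans (hw.mono (del_sub _ _))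
    · exact Rch.arc (by simpa using (mem_del.1 hb).1)

theorem Cfg.subdiv {U : Subgroup G} {l : ℕ} {V : Finset ℕ} {E : Finset (Arc G)} (h : Cfg U l V E)
    {i j n : ℕ} {f₁ f₂ : G} (ha : OE E (i, j, f₁ * f₂)) (hn : n ∉ V) :
    Cfg U l (insert n V)
      (insert (i, n, f₁) (insert (n, j, f₂) (del E (i, j, f₁ * f₂)))) := by
  set E' : Finset (Arc G) := insert (i, n, f₁) (insert (n, j, f₂) (del E (i, j, f₁ * f₂))) with hE'
  have hiV := (ha.ends h).1
  have hjV := (ha.ends h).2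
  have m1 : Rch (E' : Set (Arc G)) i n f₁ := Rch.arc (by simp [hE'])
  have m2 : Rch (E' : Set (Arc G)) n j f₂ := Rch.arc (by simp [hE'])
  have k1 : ∀ {x y b}, Rch (E : Set (Arc G)) x y b → Rch (E' : Set (Arc G)) x y b := by
    intro x y b hr
    refine hr.gen fun x y b hb => del_recover (E := E) (a := (i, j, f₁ * f₂)) ?_ (m1.trans m2) x y b
      (by simpa using hb)
    intro x hx; simp [hE'] at hx ⊢; tauto
  have hni : i ≠ n := fun e => hn (e ▸ hiV)
  have hnj : j ≠ n := fun e => hn (e ▸ hjV)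
  have k2 : ∀ {x y b}, Rch (E' : Set (Arc G)) x y b → x ≠ n → y ≠ n → Rch (E : Set (Arc G)) x y b := by
    intro x y b hr hx hy
    have := Rch.map (E' := (E : Set (Arc G))) (fun x => if x = n then i else x)
      (fun x => if x = n then f₁ else 1) ?_ hr
    · simpa [hx, hy] using this
    · intro x y b hb
      rw [Finset.mem_coe, hE', Finset.mem_insert, Finset.mem_insert] at hb
      rcases hb with hb | hb | hb
      · simp only [Prod.mk.injEq] at hb
        obtain ⟨rfl, rfl, rfl⟩ := hb
        simpa [hni] using Rch.refl _
      · simp only [Prod.mk.injEq] at hb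
        obtain ⟨rfl, rfl, rfl⟩ := hb
        simpa [hnj] using ha.rch
      · have hb := (mem_del.1 hb).1
        have e := h.ends _ hb
        have hx : x ≠ n := fun e' => hn (e' ▸ e.1)
        have hy : y ≠ n := fun e' => hn (e' ▸ e.2)
        simpa [hx, hy] using Rch.arc (E := (E : Set (Arc G))) (by simpa using hb)
  refine ⟨?_, ?_, ?_, ?_⟩
  · intro a haa
    rw [hE', Finset.mem_insert, Finset.mem_insert] at haa
    rcases haa with rfl | rfl | haa
    · simp [hiV]
    · simp [hjV]
    · have := h.ends _ (mem_del.1 haa).1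
      simp [this]
  · have hto : ∀ x ∈ insert n V, ∃ g, Rch (E' : Set (Arc G)) i x g := by
      intro x hx
      rcases Finset.mem_insert.1 hx with rfl | hx
      · exact ⟨_, m1⟩
      · obtain ⟨g, hg⟩ := h.conn i hiV x hx
        exact ⟨g, k1 hg⟩
    intro x hx y hy
    obtain ⟨p, hp⟩ := hto x hx
    obtain ⟨q, hq⟩ := hto y hy
    exact ⟨_, hp.symm.trans hq⟩
  · have c1 := card_del ha
    have c2 := Finset.card_insert_le (i, n, f₁) (insert (n, j, f₂) (del E (i, j, f₁ * f₂)))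
    have c3 := Finset.card_insert_le (n, j, f₂) (del E (i, j, f₁ * f₂))
    have c4 := Finset.card_insert_of_notMem hn
    have c5 := h.card
    rw [← hE'] at c2
    omega
  · obtain ⟨c, hc⟩ := h.all i hiV
    exact ⟨i, by simp [hiV], c, fun g =>
      ⟨fun hg => (hc g).1 (k2 hg hni hni), fun hg => k1 ((hc g).2 hg)⟩⟩

/-- cost-minimal configuration -/
def MinCfg (len : G → ℕ) (U : Subgroup G) (l : ℕ) (V : Finset ℕ) (E : Finset (Arc G)) : Prop :=
  Cfg U l V E ∧ ∀ V' E', Cfg U l V' E' → cost len E ≤ cost len E'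

theorem exists_min (U : Subgroup G) (l : ℕ) (T : Finset G) (hT : T.card ≤ l)
    (hU : Subgroup.closure (T : Set G) = U) : ∃ V E, MinCfg len U l V E := by
  have hex : ∃ n, ∃ V E, Cfg U l V E ∧ cost len E = n := by
    refine ⟨_, {0}, T.image (fun t => ((0 : ℕ), (0 : ℕ), t)), ⟨?_, ?_, ?_, ?_⟩, rfl⟩
    · intro a ha
      obtain ⟨t, _, rfl⟩ := Finset.mem_image.1 ha
      simp
    · intro i hi j hj
      rw [Finset.mem_singleton] at hi hj
      subst hi; subst hj
      exact ⟨1, Rch.refl _⟩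
    · have := Finset.card_image_le (s := T) (f := fun t => ((0 : ℕ), (0 : ℕ), t))
      simp; omega
    · refine ⟨0, by simp, 1, fun g => ?_⟩
      simp only [one_mul, inv_one, mul_one]
      constructor
      · have key : ∀ i j g, Rch ((T.image (fun t => ((0 : ℕ), (0 : ℕ), t)) : Finset (Arc G)) :
            Set (Arc G)) i j g → g ∈ U := ?_
        · exact key 0 0 g
        intro i j g h
        induction h with
        | refl => exact U.one_mem
        | fwd _ hm ih =>
          refine U.mul_mem ih ?_
          rw [← hU]
          apply Subgroup.subset_closure
          simp at hm
          grind
        | bwd _ hm ih =>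
          refine U.mul_mem ih (U.inv_mem ?_)
          rw [← hU]
          apply Subgroup.subset_closure
          simp at hm
          grind
      · intro h
        have : U ≤ vgrp ((T.image (fun t => ((0 : ℕ), (0 : ℕ), t)) : Finset (Arc G)) : Set (Arc G)) 0 := by
          rw [← hU, Subgroup.closure_le]
          intro t ht
          exact Rch.arc (by simpa using ht)
        exact this h
  obtain ⟨V, E, hc, he⟩ := Nat.find_spec hex
  exact ⟨V, E, hc, fun V' E' h' => he ▸ Nat.find_min' hex ⟨V', E', h', rfl⟩⟩

variable {U : Subgroup G} {l : ℕ} {V : Finset ℕ} {E : Finset (Arc G)}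

theorem MinCfg.rep (H : HypLen len D) (h : MinCfg len U l V E)
    {i j n : ℕ} {g w : G} (ha : OE E (i, j, g)) (hn : n ∈ V)
    (hw : Rch (del E (i, j, g) : Set (Arc G)) j n w) : len g ≤ len (g * w) := by
  have h1 := h.2 _ _ (h.1.rep ha hn hw)
  have h2 := cost_insert (len := len) (i, n, g * w) (del E (i, j, g))
  have h3 := cost_del H ha
  simp only at h2 h3
  omega

theorem MinCfg.norev (h : MinCfg len U l V E) {e : Arc G} (he : e ∈ E)
    (he' : rev e ∈ E) : rev e = e := by
  by_contra hne
  have hsub : E.erase (rev e) ⊆ E := Finset.erase_subset _ _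
  have hcard := card_sub hsub he' (by simp)
  have hcost := cost_sub (len := len) hsub he' (by simp)
  have : Cfg U l V (E.erase (rev e)) := by
    apply h.1.same
    · intro a ha; exact h.1.ends _ (hsub ha)
    · omega
    · intro i j a ha
      by_cases hh : (i, j, a) = rev e
      · have hm : (j, i, a⁻¹) ∈ E.erase (rev e) := by
          have e1 : rev (i, j, a) = e := by rw [hh]; simp
          simp only [rev] at e1
          rw [e1]
          exact Finset.mem_erase.2 ⟨fun e => hne e.symm, he⟩
        simpa using (Rch.arc (Finset.mem_coe.2 hm)).symm
      · exact Rch.arc (Finset.mem_coe.2 (Finset.mem_erase.2 ⟨hh, ha⟩))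
    · intro i j a ha; exact Rch.arc (Finset.mem_coe.2 (hsub ha))
  have := h.2 _ _ this
  omega

theorem MinCfg.turnA (H : HypLen len D) (h : MinCfg len U l V E)
    {i j k m : ℕ} {g f₁ f₂ w : G} (ha : OE E (i, j, g)) (ha' : OE E (k, m, f₁ * f₂))
    (hlen : len f₁ + len f₂ = len (f₁ * f₂))
    (hne : (i, j, g) ≠ (k, m, f₁ * f₂)) (hne' : (i, j, g) ≠ rev (k, m, f₁ * f₂))
    (Es : Set (Arc G)) (hEs : ∀ x ∈ Es, x ∈ del E (i, j, g) ∧ x ∈ del E (k, m, f₁ * f₂))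
    (hw : Rch Es j m w) : len g ≤ len (g * (w * f₂⁻¹)) + 1 := by
  obtain ⟨n, hn⟩ := Infinite.exists_notMem_finset V
  have hc1 := h.1.subdiv ha' hn
  set E1 : Finset (Arc G) := insert (k, n, f₁) (insert (n, m, f₂) (del E (k, m, f₁ * f₂))) with hE1
  have ends := ha.ends h.1
  have ends' := ha'.ends h.1
  simp only at ends ends'
  have hin : i ≠ n := fun e => hn (e ▸ ends.1)
  have hjn : j ≠ n := fun e => hn (e ▸ ends.2)
  have ha1 : OE E1 (i, j, g) := by
    rcases ha with ha | ha
    · left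
      simp only [hE1, Finset.mem_insert, mem_del]
      exact Or.inr (Or.inr ⟨ha, hne, hne'⟩)
    · right
      simp only [hE1, Finset.mem_insert, mem_del]
      refine Or.inr (Or.inr ⟨ha, fun e => hne' ?_, fun e => hne ?_⟩)
      · rw [← e, rev_rev]
      · rw [← rev_rev (i, j, g), e, rev_rev]
  have hw1 : Rch (del E1 (i, j, g) : Set (Arc G)) j n (w * f₂⁻¹) := by
    refine (hw.mono ?_).bwd (k := n) ?_
    · intro x hx
      obtain ⟨h1, h2⟩ := hEs x hx
      rw [Finset.mem_coe, mem_del]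
      exact ⟨by simp only [hE1, Finset.mem_insert]; exact Or.inr (Or.inr h2), (mem_del.1 h1).2⟩
    · rw [Finset.mem_coe, mem_del]
      refine ⟨by simp [hE1], ?_, ?_⟩
      · intro e; simp only [Prod.mk.injEq] at e; exact hin e.1.symm
      · intro e; simp only [rev, Prod.mk.injEq] at e; exact hjn e.1.symm
  have h1 := h.2 _ _ (hc1.rep ha1 (by simp) hw1)
  have h2 := cost_insert (len := len) (i, n, g * (w * f₂⁻¹)) (del E1 (i, j, g))
  have h3 := cost_del H ha1
  have h4 := cost_insert (len := len) (k, n, f₁) (insert (n, m, f₂) (del E (k, m, f₁ * f₂)))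
  have h5 := cost_insert (len := len) (n, m, f₂) (del E (k, m, f₁ * f₂))
  have h6 := cost_del H ha'
  simp only at h2 h3 h4 h5 h6
  rw [← hE1] at h4
  omega

theorem MinCfg.turnB (H : HypLen len D) (h : MinCfg len U l V E)
    {k m : ℕ} {f₁ f₂ w : G} (ha' : OE E (k, m, f₁ * f₂))
    (hlen : len f₁ + len f₂ = len (f₁ * f₂)) (hne : f₁ * f₂ ≠ 1)
    (Es : Set (Arc G)) (hEs : ∀ x ∈ Es, x ∈ del E (k, m, f₁ * f₂))
    (hw : Rch Es k m w) : len f₁ ≤ len (f₁⁻¹ * (w * f₂⁻¹)) + 1 := by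
  obtain ⟨n, hn⟩ := Infinite.exists_notMem_finset V
  have hc1 := h.1.subdiv ha' hn
  set E1 : Finset (Arc G) := insert (k, n, f₁) (insert (n, m, f₂) (del E (k, m, f₁ * f₂))) with hE1
  have ends' := ha'.ends h.1
  simp only at ends'
  have hkn : k ≠ n := fun e => hn (e ▸ ends'.1)
  have hmn : m ≠ n := fun e => hn (e ▸ ends'.2)
  have ha1 : OE E1 (n, k, f₁⁻¹) := by
    right; simp [rev, hE1]
  have hw1 : Rch (del E1 (n, k, f₁⁻¹) : Set (Arc G)) k n (w * f₂⁻¹) := by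
    refine (hw.mono ?_).bwd (k := n) ?_
    · intro x hx
      have h1 := hEs x hx
      have h2 := h.1.ends _ (mem_del.1 h1).1
      rw [Finset.mem_coe, mem_del]
      refine ⟨by simp only [hE1, Finset.mem_insert]; exact Or.inr (Or.inr h1), ?_, ?_⟩
      · rintro rfl; exact hn h2.1
      · rintro rfl; exact hn h2.2
    · rw [Finset.mem_coe, mem_del]
      refine ⟨by simp [hE1], ?_, ?_⟩
      · intro e; simp only [Prod.mk.injEq] at e
        apply hne; rw [e.2.2]; group
      · intro e; simp only [rev, Prod.mk.injEq] at e; exact hkn e.1.symm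
  have h1 := h.2 _ _ (hc1.rep ha1 (by simp) hw1)
  have h2 := cost_insert (len := len) (n, n, f₁⁻¹ * (w * f₂⁻¹)) (del E1 (n, k, f₁⁻¹))
  have h3 := cost_del H ha1
  have h4 := cost_insert (len := len) (k, n, f₁) (insert (n, m, f₂) (del E (k, m, f₁ * f₂)))
  have h5 := cost_insert (len := len) (n, m, f₂) (del E (k, m, f₁ * f₂))
  have h6 := cost_del H ha'
  simp only [H.inv] at h2 h3 h4 h5 h6
  rw [← hE1] at h4
  omega

theorem Cfg.elim (h : Cfg U l V E) {k i : ℕ} (hk : k ∈ V) (hi : i ∈ V) (hik : i ≠ k) (g : G)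
    {E' : Finset (Arc G)} (he : ∀ a ∈ E', a.1 ∈ V.erase k ∧ a.2.1 ∈ V.erase k)
    (hc : E'.card + 1 ≤ E.card)
    (h2 : ∀ i j a, (i, j, a) ∈ E' → Rch (E : Set (Arc G)) i j a)
    (h1 : ∀ p q b, (p, q, b) ∈ E → Rch (E' : Set (Arc G)) (if p = k then i else p)
      (if q = k then i else q) ((if p = k then g else 1) * b * (if q = k then g else 1)⁻¹)) :
    Cfg U l (V.erase k) E' := by
  have k1 : ∀ {p q b}, Rch (E : Set (Arc G)) p q b → p ≠ k → q ≠ k →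
      Rch (E' : Set (Arc G)) p q b := by
    intro p q b hr hp hq
    have := Rch.map (E' := (E' : Set (Arc G))) (fun p => if p = k then i else p)
      (fun p => if p = k then g else 1) (fun p q b hb => h1 p q b (by simpa using hb)) hr
    simpa [hp, hq] using this
  have k2 : ∀ {p q b}, Rch (E' : Set (Arc G)) p q b → Rch (E : Set (Arc G)) p q b :=
    fun hr => hr.gen (by simpa using h2)
  refine ⟨he, fun p hp q hq => ?_, ?_, ?_⟩
  · rw [Finset.mem_erase] at hp hq
    obtain ⟨g, hg⟩ := h.conn p hp.2 q hq.2
    exact ⟨g, k1 hg hp.1 hq.1⟩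
  · have := h.card
    have := Finset.card_erase_of_mem hk
    have := Finset.card_pos.2 ⟨k, hk⟩
    omega
  · obtain ⟨c, hc⟩ := h.all i hi
    exact ⟨i, by simp [hi, hik], c, fun g =>
      ⟨fun hg => (hc g).1 (k2 hg), fun hg => k1 ((hc g).2 hg) hik hik⟩⟩

theorem exists_leave {k j : ℕ} {g : G} (hr : Rch (E : Set (Arc G)) k j g) (hj : j ≠ k) :
    ∃ i g, i ≠ k ∧ OE E (i, k, g) := by
  suffices h : ∀ x, Rch (E : Set (Arc G)) x j g → x = k → ∃ i g, i ≠ k ∧ OE E (i, k, g) from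
    h k hr rfl
  intro x hx hxk
  clear hr
  induction hx with
  | refl => exact absurd hxk hj
  | @fwd z w g a hr hm ih =>
    by_cases hz : z = k
    · subst hz
      exact ⟨w, a⁻¹, hj, Or.inr (by simpa [rev] using hm)⟩
    · exact ih hz
  | @bwd z w g a hr hm ih =>
    by_cases hz : z = k
    · subst hz
      exact ⟨w, a, hj, Or.inl (by simpa [rev] using hm)⟩
    · exact ih hz

theorem MinCfg.val (H : HypLen len D) (h : MinCfg len U l V E) (hV : 2 ≤ V.card) {k : ℕ}
    (hk : k ∈ V) : 3 ≤ (E.filter (fun x => x.1 = k)).card + (E.filter (fun x => x.2.1 = k)).card := by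
  by_contra hlt
  push Not at hlt
  obtain ⟨j0, hj0, hj0k⟩ := Finset.exists_mem_ne (s := V) (by omega) k
  obtain ⟨p0, hp0⟩ := h.1.conn k hk j0 hj0
  obtain ⟨i, g, hik, hOE⟩ := exists_leave hp0 hj0k
  have hiV := (hOE.ends h.1).1
  simp only at hiV
  set E0 : Finset (Arc G) := E.filter (fun x => x.1 ≠ k ∧ x.2.1 ≠ k) with hE0
  have hE0s : E0 ⊆ E := Finset.filter_subset _ _
  set F : Finset (Arc G) := E.filter (fun x => x.1 = k) ∪ E.filter (fun x => x.2.1 = k) with hF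
  have hFm : ∀ x, x ∈ F ↔ x ∈ E ∧ (x.1 = k ∨ x.2.1 = k) := by
    intro x; simp only [hF, Finset.mem_union, Finset.mem_filter]; tauto
  have hcard := Finset.card_union_add_card_inter (E.filter (fun x => x.1 = k))
    (E.filter (fun x => x.2.1 = k))
  rw [← hF] at hcard
  obtain ⟨a', ha'E, ha'⟩ : ∃ a' ∈ E, a' = (i, k, g) ∨ a' = rev (i, k, g) := by
    rcases hOE with hh | hh
    · exact ⟨_, hh, Or.inl rfl⟩
    · exact ⟨_, hh, Or.inr rfl⟩
  have ha'F : a' ∈ F := by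
    rw [hFm]; refine ⟨ha'E, ?_⟩
    rcases ha' with rfl | rfl <;> simp [rev]
  have ha'len : len a'.2.2 = len g := by
    rcases ha' with rfl | rfl <;> simp [rev, H.inv]
  have ha'0 : a' ∉ E0 := by
    rcases ha' with rfl | rfl <;> simp [hE0, rev]
  have hE0V : ∀ a ∈ E0, a.1 ∈ V.erase k ∧ a.2.1 ∈ V.erase k := by
    intro a ha
    rw [hE0, Finset.mem_filter] at ha
    have := h.1.ends a ha.1
    simp [ha.2, this]
  have harc : ∀ E' : Finset (Arc G), ∀ p q b, (p, q, b) = a' →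
      Rch (E' : Set (Arc G)) (if p = k then i else p)
      (if q = k then i else q) ((if p = k then g else 1) * b * (if q = k then g else 1)⁻¹) := by
    intro E' p q b he
    rcases ha' with rfl | rfl
    · simp only [Prod.mk.injEq] at he
      obtain ⟨rfl, rfl, rfl⟩ := he
      simpa [hik] using Rch.refl _
    · simp only [rev, Prod.mk.injEq] at he
      obtain ⟨rfl, rfl, rfl⟩ := he
      simpa [hik] using Rch.refl _
  have harc0 : ∀ E' : Finset (Arc G), E0 ⊆ E' → ∀ p q b, (p, q, b) ∈ E0 →
      Rch (E' : Set (Arc G)) (if p = k then i else p)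
      (if q = k then i else q) ((if p = k then g else 1) * b * (if q = k then g else 1)⁻¹) := by
    intro E' hE' p q b he
    have he' := he
    rw [hE0, Finset.mem_filter] at he'
    simp only at he'
    simpa [he'.2.1, he'.2.2] using Rch.arc (Finset.mem_coe.2 (hE' he))
  have hEF : ∀ x ∈ E, x ∈ E0 ∨ x ∈ F := by
    intro x hx
    rw [hFm, hE0, Finset.mem_filter]; tauto
  by_cases hone : ∃ x ∈ F, x ≠ a'
  · obtain ⟨x, hxF, hxa⟩ := hone
    have hxE := ((hFm x).1 hxF).1
    have hFc : ({x, a'} : Finset (Arc G)).card ≤ F.card :=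
      Finset.card_le_card (by
        intro y hy
        rcases Finset.mem_insert.1 hy with rfl | hy
        · exact hxF
        · rw [Finset.mem_singleton.1 hy]; exact ha'F)
    have hFe : ({x, a'} : Finset (Arc G)) = F := by
      apply Finset.eq_of_subset_of_card_le
      · intro y hy
        rcases Finset.mem_insert.1 hy with rfl | hy
        · exact hxF
        · rw [Finset.mem_singleton.1 hy]; exact ha'F
      · rw [Finset.card_pair hxa]; omega
    rw [Finset.card_pair hxa] at hFc
    have hnl : ¬ (x.1 = k ∧ x.2.1 = k) := by
      intro hh
      have : 0 < (E.filter (fun x => x.1 = k) ∩ E.filter (fun x => x.2.1 = k)).card :=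
        Finset.card_pos.2 ⟨x, by simp [hxE, hh]⟩
      omega
    obtain ⟨j, f, hjk, hx⟩ : ∃ j f, j ≠ k ∧ (x = (k, j, f) ∨ x = rev (k, j, f)) := by
      rcases ((hFm x).1 hxF).2 with hh | hh
      · refine ⟨x.2.1, x.2.2, fun e => hnl ⟨hh, e⟩, Or.inl ?_⟩
        rw [← hh]
      · refine ⟨x.1, x.2.2⁻¹, fun e => hnl ⟨e, hh⟩, Or.inr ?_⟩
        rw [← hh]; simp [rev]
    have hxOE : OE E (k, j, f) := by
      rcases hx with rfl | rfl
      · exact Or.inl hxE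
      · exact Or.inr hxE
    have hjV := (hxOE.ends h.1).2
    simp only at hjV
    have hxlen : len x.2.2 = len f := by
      rcases hx with rfl | rfl <;> simp [rev, H.inv]
    have hx0 : x ∉ E0 := by
      rcases hx with rfl | rfl <;> simp [hE0, rev]
    have s1 : E0 ⊆ E.erase a' := fun y hy =>
      Finset.mem_erase.2 ⟨fun e => ha'0 (e ▸ hy), hE0s hy⟩
    have s2 : x ∈ E.erase a' := Finset.mem_erase.2 ⟨hxa, hxE⟩
    have c1 := card_sub s1 s2 hx0
    have c2 := card_sub (Finset.erase_subset a' E) ha'E (by simp)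
    have d1 := cost_sub (len := len) s1 s2 hx0
    have d2 := cost_sub (len := len) (Finset.erase_subset a' E) ha'E (by simp)
    have c3 := Finset.card_insert_le (i, j, g * f) E0
    have d3 := cost_insert (len := len) (i, j, g * f) E0
    have d4 := H.mul g f
    have hcfg : Cfg U l (V.erase k) (insert (i, j, g * f) E0) := by
      apply h.1.elim hk hiV hik g
      · intro a ha
        rcases Finset.mem_insert.1 ha with rfl | ha
        · simp [hik, hiV, hjk, hjV]
        · exact hE0V a ha
      · omega
      · intro p q b hb
        rcases Finset.mem_insert.1 hb with hb | hb
        · simp only [Prod.mk.injEq] at hb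
          obtain ⟨rfl, rfl, rfl⟩ := hb
          exact hOE.rch.trans hxOE.rch
        · exact Rch.arc (Finset.mem_coe.2 (hE0s hb))
      · intro p q b hb
        rcases hEF _ hb with hb | hb
        · exact harc0 _ (Finset.subset_insert _ _) p q b hb
        · rw [← hFe] at hb
          rcases Finset.mem_insert.1 hb with hb | hb
          · have hm : Rch ((insert (i, j, g * f) E0 : Finset (Arc G)) : Set (Arc G)) i j (g * f) :=
              Rch.arc (by simp)
            rcases hx with rfl | rfl
            · simp only [Prod.mk.injEq] at hb
              obtain ⟨rfl, rfl, rfl⟩ := hb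
              simpa [hjk] using hm
            · simp only [rev, Prod.mk.injEq] at hb
              obtain ⟨rfl, rfl, rfl⟩ := hb
              simpa [hjk] using hm.symm
          · exact harc _ p q b (Finset.mem_singleton.1 hb)
    have := h.2 _ _ hcfg
    simp only at d3
    omega
  · push Not at hone
    have d2 := cost_sub (len := len) hE0s ha'E ha'0
    have c2 := card_sub hE0s ha'E ha'0
    have hcfg : Cfg U l (V.erase k) E0 := by
      apply h.1.elim hk hiV hik g hE0V c2
      · intro p q b hb
        exact Rch.arc (Finset.mem_coe.2 (hE0s hb))
      · intro p q b hb
        rcases hEF _ hb with hb | hb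
        · exact harc0 _ subset_rfl p q b hb
        · exact harc _ p q b (hone _ hb)
    have := h.2 _ _ hcfg
    omega

theorem MinCfg.min_card (H : HypLen len D) (h : MinCfg len U l V E) (hl : 1 ≤ l) :
    V.card ≤ 2 * l ∧ E.card ≤ 3 * l := by
  have hc := h.1.card
  by_cases hV : 2 ≤ V.card
  · have e1 := Finset.card_eq_sum_card_fiberwise (f := fun x : Arc G => x.1) (s := E) (t := V)
      (fun x hx => (h.1.ends x hx).1)
    have e2 := Finset.card_eq_sum_card_fiberwise (f := fun x : Arc G => x.2.1) (s := E) (t := V)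
      (fun x hx => (h.1.ends x hx).2)
    have e3 : ∑ k ∈ V, 3 ≤ ∑ k ∈ V, ((E.filter (fun x => x.1 = k)).card +
        (E.filter (fun x => x.2.1 = k)).card) :=
      Finset.sum_le_sum fun k hk => h.val H hV hk
    rw [Finset.sum_add_distrib] at e3
    simp only [Finset.sum_const, smul_eq_mul] at e3
    omega
  · omega

end Graph
end KWP

namespace KWP

noncomputable section Short

open Classical

variable {G : Type*} [Group G] {len : G → ℕ} {D : ℕ}
variable {U : Subgroup G} {l : ℕ} {V : Finset ℕ} {E : Finset (Arc G)}

theorem short_path (H : HypLen len D) {F : Finset (Arc G)} {r : ℕ}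
    (hF : ∀ a ∈ F, len a.2.2 ≤ r) (hV : ∀ a ∈ F, a.1 ∈ V ∧ a.2.1 ∈ V) {i j : ℕ} {g : G}
    (hi : i ∈ V) (hr : Rch (F : Set (Arc G)) i j g) :
    ∃ c, Rch (F : Set (Arc G)) i j c ∧ len c ≤ r * V.card := by
  let P : Finset (Finset ℕ) := V.powerset.filter (fun S => i ∈ S ∧
    ∀ j ∈ S, ∃ c, Rch (F : Set (Arc G)) i j c ∧ len c ≤ r * S.card)
  have hP : P.Nonempty := by
    refine ⟨{i}, ?_⟩
    simp only [P, Finset.mem_filter, Finset.mem_powerset, Finset.singleton_subset_iff]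
    refine ⟨hi, by simp, fun j hj => ?_⟩
    rw [Finset.mem_singleton] at hj
    subst hj
    exact ⟨1, Rch.refl _, by simp [H.one]⟩
  obtain ⟨S, hSP, hmax⟩ := Finset.exists_max_image P Finset.card hP
  simp only [P, Finset.mem_filter, Finset.mem_powerset] at hSP hmax
  obtain ⟨hSV, hiS, hS⟩ := hSP
  have hadd : ∀ k ∈ V, (∃ c, Rch (F : Set (Arc G)) i k c ∧ len c ≤ r * S.card + r) → k ∈ S := by
    intro k hk hc
    by_contra hkS
    have := hmax (insert k S) ⟨Finset.insert_subset hk hSV, by simp [hiS], ?_⟩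
    · rw [Finset.card_insert_of_notMem hkS] at this; omega
    · rw [Finset.card_insert_of_notMem hkS]
      intro m hm
      rcases Finset.mem_insert.1 hm with rfl | hm
      · obtain ⟨c, h1, h2⟩ := hc
        exact ⟨c, h1, by rw [mul_add]; omega⟩
      · obtain ⟨c, h1, h2⟩ := hS m hm
        exact ⟨c, h1, by rw [mul_add]; omega⟩
  have hall : j ∈ S := by
    have : ∀ x, Rch (F : Set (Arc G)) x j g → x = i → j ∈ S := by
      intro x hx hxi
      clear hr
      induction hx with
      | refl => rw [hxi]; exact hiS
      | @fwd z w g a hr hm ih =>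
        obtain ⟨c, h1, h2⟩ := hS z ih
        have hm' : (z, w, a) ∈ F := by simpa using hm
        refine hadd w (hV _ hm').2 ⟨c * a, h1.fwd hm, ?_⟩
        have := H.mul c a
        have := hF _ hm'
        simp only at this
        omega
      | @bwd z w g a hr hm ih =>
        obtain ⟨c, h1, h2⟩ := hS z ih
        have hm' : (w, z, a) ∈ F := by simpa using hm
        refine hadd w (hV _ hm').1 ⟨c * a⁻¹, h1.bwd hm, ?_⟩
        have := H.mul c a⁻¹
        have := hF _ hm'
        have := H.inv a
        simp only at *
        omega
    exact this i hr rfl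
  obtain ⟨c, h1, h2⟩ := hS j hall
  refine ⟨c, h1, h2.trans (Nat.mul_le_mul_left r (Finset.card_le_card hSV))⟩

theorem vgrp_gen (H : HypLen len D) {F : Finset (Arc G)} {r : ℕ}
    (hF : ∀ a ∈ F, len a.2.2 ≤ r) (hV : ∀ a ∈ F, a.1 ∈ V ∧ a.2.1 ∈ V) {i : ℕ}
    (hi : i ∈ V) :
    ∃ S : Set G, (∀ s ∈ S, len s ≤ 2 * (r * V.card) + r) ∧
      vgrp (F : Set (Arc G)) i = Subgroup.closure S := by
  refine ⟨{u | u ∈ vgrp (F : Set (Arc G)) i ∧ len u ≤ 2 * (r * V.card) + r}, fun s hs => hs.2, ?_⟩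
  set K := Subgroup.closure {u | u ∈ vgrp (F : Set (Arc G)) i ∧ len u ≤ 2 * (r * V.card) + r}
    with hK
  apply le_antisymm
  · have hc : ∀ j, ∃ c, (∃ g, Rch (F : Set (Arc G)) i j g) →
        Rch (F : Set (Arc G)) i j c ∧ len c ≤ r * V.card := by
      intro j
      by_cases h : ∃ g, Rch (F : Set (Arc G)) i j g
      · obtain ⟨g, hg⟩ := h
        obtain ⟨c, hc⟩ := short_path H hF hV hi hg
        exact ⟨c, fun _ => hc⟩
      · exact ⟨1, fun h' => absurd h' h⟩
    choose c hc using hc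
    have main : ∀ x k g, Rch (F : Set (Arc G)) x k g → x = i → g * (c k)⁻¹ ∈ K := by
      intro x k g hr hx
      induction hr with
      | refl =>
        subst hx
        have := hc _ ⟨1, Rch.refl _⟩
        rw [one_mul]
        apply K.inv_mem
        apply Subgroup.subset_closure
        exact ⟨this.1, by omega⟩
      | @fwd z w g a hr hm ih =>
        subst hx
        have h1 := hc z ⟨_, hr⟩
        have h2 := hc w ⟨_, hr.fwd hm⟩
        have e : g * a * (c w)⁻¹ = (g * (c z)⁻¹) * (c z * a * (c w)⁻¹) := by group
        rw [e]
        refine K.mul_mem ih (Subgroup.subset_closure ⟨(h1.1.fwd hm).trans h2.1.symm, ?_⟩)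
        have := hF _ (Finset.mem_coe.1 hm)
        have := H.mul (c z * a) (c w)⁻¹
        have := H.mul (c z) a
        have := H.inv (c w)
        simp only at *
        omega
      | @bwd z w g a hr hm ih =>
        subst hx
        have h1 := hc z ⟨_, hr⟩
        have h2 := hc w ⟨_, hr.bwd hm⟩
        have e : g * a⁻¹ * (c w)⁻¹ = (g * (c z)⁻¹) * (c z * a⁻¹ * (c w)⁻¹) := by group
        rw [e]
        refine K.mul_mem ih (Subgroup.subset_closure ⟨(h1.1.bwd hm).trans h2.1.symm, ?_⟩)
        have := hF _ (Finset.mem_coe.1 hm)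
        have := H.mul (c z * a⁻¹) (c w)⁻¹
        have := H.mul (c z) a⁻¹
        have := H.inv (c w)
        have := H.inv a
        simp only at *
        omega
    intro g hg
    have h1 := main i i g hg rfl
    have h2 := main i i 1 (Rch.refl i) rfl
    have : g = g * (c i)⁻¹ * (1 * (c i)⁻¹)⁻¹ := by group
    rw [this]
    exact K.mul_mem h1 (K.inv_mem h2)
  · rw [hK, Subgroup.closure_le]
    exact fun u hu => hu.1

/-- quasiconvexity and the displacement property, with a common constant -/
def Good (len : G → ℕ) (c B : ℕ) (K : Subgroup G) : Prop :=
  QC len B K ∧ ∀ x, ∀ u ∈ K, u ≠ 1 → ds len x (u * x) ≤ c → ∃ h ∈ K, ds len x h ≤ B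

theorem Good.mono {c B B' : ℕ} (hB : B ≤ B') {K : Subgroup G} (h : Good len c B K) :
    Good len c B' K := by
  refine ⟨fun x hx p hp => ?_, fun x u hu h1 h2 => ?_⟩
  · obtain ⟨k, hk, hd⟩ := h.1 x hx p hp
    exact ⟨k, hk, hd.trans hB⟩
  · obtain ⟨k, hk, hd⟩ := h.2 x u hu h1 h2
    exact ⟨k, hk, hd.trans hB⟩

theorem unif (H : HypLen len D)
    (hATF : ∀ g : G, g ≠ 1 → IsOfFinOrder g →
      ((Subgroup.centralizer {g} : Subgroup G) : Set G).Finite)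
    (hQC : ∀ T : Finset G, ∃ ε, QC len ε (Subgroup.closure (T : Set G))) (c M : ℕ) :
    ∃ B, ∀ S : Set G, (∀ s ∈ S, len s ≤ M) → Good len c B (Subgroup.closure S) := by
  have h1 : ∀ T : Finset G, ∃ B, Good len c B (Subgroup.closure (T : Set G)) := by
    intro T
    obtain ⟨ε, hε⟩ := hQC T
    obtain ⟨R, hR⟩ := key H hATF hε c
    refine ⟨ε + R, fun x hx p hp => ?_, fun x u hu h1 h2 => ?_⟩
    · obtain ⟨k, hk, hd⟩ := hε x hx p hp
      exact ⟨k, hk, by omega⟩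
    · obtain ⟨k, hk, hd⟩ := hR x u hu h1 h2
      exact ⟨k, hk, by omega⟩
  choose B hB using h1
  refine ⟨(H.ball M).toFinset.powerset.sup B, fun S hS => ?_⟩
  have hfin : S.Finite := (H.ball M).subset fun s hs => hS s hs
  have := hB hfin.toFinset
  rw [Set.Finite.coe_toFinset] at this
  refine this.mono (Finset.le_sup (f := B) ?_)
  rw [Finset.mem_powerset]
  intro x hx
  rw [Set.Finite.mem_toFinset] at hx ⊢
  exact hS x hx

/-- short arcs -/
def sh (len : G → ℕ) (r : ℕ) (E : Finset (Arc G)) : Finset (Arc G) :=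
  E.filter fun a => len a.2.2 ≤ r

theorem mem_sh {r : ℕ} {a : Arc G} : a ∈ sh len r E ↔ a ∈ E ∧ len a.2.2 ≤ r := by
  simp [sh]

theorem sh_del (H : HypLen len D) {r : ℕ} {a : Arc G} (ha : r < len a.2.2) :
    ∀ x ∈ (sh len r E : Set (Arc G)), x ∈ del E a := by
  intro x hx
  rw [Finset.mem_coe, mem_sh] at hx
  refine mem_del.2 ⟨hx.1, ?_, ?_⟩
  · rintro rfl; omega
  · rintro rfl
    have := H.inv a.2.2
    simp only [rev] at hx
    omega

theorem rep_dist (H : HypLen len D) (h : MinCfg len U l V E) {r i j : ℕ} {μ ν u q : G} {t : ℕ}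
    (ha : OE E (i, j, μ⁻¹ * ν)) (hl : len μ + len ν = len (μ⁻¹ * ν)) (hlong : r < len (μ⁻¹ * ν))
    (hu : Rch (sh len r E : Set (Arc G)) j j u) (hq : On len 1 ν⁻¹ q) (ht : ds len 1 q = t) :
    t ≤ ds len q u := by
  have h1 := h.rep H ha (ha.ends h.1).2
    (hu.mono (E' := (del E (i, j, μ⁻¹ * ν) : Set (Arc G)))
      (fun x hx => sh_del H (a := (i, j, μ⁻¹ * ν)) hlong x hx))
  have e1 : len (μ⁻¹ * ν * u) = ds len (μ⁻¹ * ν)⁻¹ u := by simp [ds]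
  have e2 := ds_tri H (μ⁻¹ * ν)⁻¹ ν⁻¹ u
  have e3 := ds_tri H ν⁻¹ q u
  have e4 : ds len (μ⁻¹ * ν)⁻¹ ν⁻¹ = len μ := by simp [ds, H.inv]
  have e5 := ds_comm H ν⁻¹ q
  have e6 : ds len 1 ν⁻¹ = len ν := by rw [ds_one, H.inv]
  unfold On at hq
  omega

theorem turn (H : HypLen len D) (h : MinCfg len U l V E) {r B D1 : ℕ}
    (hG : ∀ j ∈ V, Good len (9 * D) B (vgrp (sh len r E : Set (Arc G)) j))
    (hD1 : ∀ i ∈ V, ∀ j g, Rch (sh len r E : Set (Arc G)) i j g →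
      ∃ c, Rch (sh len r E : Set (Arc G)) i j c ∧ len c ≤ D1)
    {i j i' j' : ℕ} {μ ν μ' ν' w : G}
    (ha : OE E (i, j, μ⁻¹ * ν)) (hl : len μ + len ν = len (μ⁻¹ * ν)) (hlong : r < len (μ⁻¹ * ν))
    (ha' : OE E (i', j', μ'⁻¹ * ν')) (hl' : len μ' + len ν' = len (μ'⁻¹ * ν'))
    (hlong' : r < len (μ'⁻¹ * ν'))
    (hw : Rch (sh len r E : Set (Arc G)) j j' w)
    (hcase : (j = j' ∧ μ = μ' ∧ ν = ν' ∧ w ≠ 1) ∨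
      (j = i' ∧ μ' = ν ∧ μ = ν') ∨
      ((i, j, μ⁻¹ * ν) ≠ (i', j', μ'⁻¹ * ν') ∧ (i, j, μ⁻¹ * ν) ≠ rev (i', j', μ'⁻¹ * ν'))) :
    ds len 1 ν⁻¹ + ds len 1 (w * ν'⁻¹) ≤ ds len ν⁻¹ (w * ν'⁻¹) + 2 * (6 * D + B + D1 + 2) := by
  by_contra hcon
  push Not at hcon
  set t := 6 * D + B + D1 + 2 with htd
  have hjV := (ha.ends h.1).2
  simp only at hjV
  have e6 : ds len 1 ν⁻¹ = len ν := by rw [ds_one, H.inv]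
  have htr := ds_tri H 1 ν⁻¹ (w * ν'⁻¹)
  obtain ⟨q, hq, hqt⟩ := exists_on H 1 ν⁻¹ t (by omega)
  obtain ⟨q', hq', hq't, hqq'⟩ := thin1 H 1 ν⁻¹ (w * ν'⁻¹) q hq (by omega)
  obtain ⟨q2, hq'2, hq2⟩ := thin H 1 (w * ν'⁻¹) w q' hq'
  have hd := ds_tri H q q' q2
  rcases hq2 with hq2 | hq2
  · obtain ⟨c, hc, hcl⟩ := hD1 j hjV j' w hw
    have hu : Rch (sh len r E : Set (Arc G)) j j (w * c⁻¹) := hw.trans hc.symm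
    obtain ⟨q3, hq23, hq3⟩ := thin H 1 w (w * c⁻¹) q2 hq2
    have hd' := ds_tri H q q2 q3
    rcases hq3 with hq3 | hq3
    · obtain ⟨u, hu', hd3⟩ := (hG j hjV).1 _ hu q3 hq3
      have := rep_dist H h ha hl hlong hu' hq hqt
      have := ds_tri H q q3 u
      omega
    · have := rep_dist H h ha hl hlong hu hq hqt
      have := ds_tri H q q3 (w * c⁻¹)
      unfold On at hq3
      have e : ds len w (w * c⁻¹) = len c := by simp [ds, H.inv]
      omega
  · set f₂ := q2⁻¹ * w with hf₂
    set f₁ := (μ'⁻¹ * ν') * f₂⁻¹ with hf₁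
    have hff : f₁ * f₂ = μ'⁻¹ * ν' := by rw [hf₁]; group
    have l2 : len f₂ = ds len q2 w := rfl
    have l1 := H.mul μ'⁻¹ (ν' * f₂⁻¹)
    have e1 : len (ν' * f₂⁻¹) = ds len (w * ν'⁻¹) q2 := by
      unfold ds; congr 1; rw [hf₂]; group
    have e2 : ds len (w * ν'⁻¹) w = len ν' := by simp [ds]
    have e3 : μ'⁻¹ * (ν' * f₂⁻¹) = f₁ := by rw [hf₁]; group
    rw [e3, H.inv] at l1
    have l3 := H.mul f₁ f₂
    rw [hff] at l3
    have hq2' := hq2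
    unfold On at hq2' hq
    have hlen : len f₁ + len f₂ = len (f₁ * f₂) := by rw [hff]; omega
    have ew : w * f₂⁻¹ = q2 := by rw [hf₂]; group
    rcases hcase with ⟨rfl, rfl, rfl, hw1⟩ | ⟨rfl, rfl, rfl⟩ | ⟨hne, hne'⟩
    · have hq20 : On len 1 ν⁻¹ (w⁻¹ * q2) := by
        apply On.symm H
        unfold On
        rw [← ds_left w ν⁻¹, ← ds_left w _ 1, ← ds_left w ν⁻¹ 1]
        simpa using hq2'
      have hs : ds len 1 (w⁻¹ * q2) = ds len q2 w := by
        rw [← ds_left w, ds_comm H]; simp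
      have r1 := rep_dist H h ha hl hlong hw hq hqt
      have r2 := rep_dist H h ha hl hlong hw.symm hq20 hs
      have r3 := ds_tri H q q2 w
      have r4 : ds len (w⁻¹ * q2) w⁻¹ = ds len q2 1 := by
        rw [← ds_left w]; simp
      have r5 := ds_tri H q2 q 1
      have r6 := ds_comm H q2 q
      have r7 := ds_comm H q 1
      have r8 := on_close H 1 ν⁻¹ q (w⁻¹ * q2) hq hq20
      have r9 : ds len q (w⁻¹ * q2) = ds len (w * q) q2 := by
        rw [← ds_left w]; simp
      have r10 := ds_tri H q q2 (w * q)
      have r11 := ds_comm H q2 (w * q)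
      obtain ⟨u, hu, hdu⟩ := (hG j hjV).2 q w hw hw1 (by omega)
      have := rep_dist H h ha hl hlong hu hq hqt
      omega
    · have hne : f₁ * f₂ ≠ 1 := by
        rw [hff]; intro e; rw [e, H.one] at hlong'; omega
      have := h.turnB H (hff ▸ ha') hlen hne _
        (sh_del H (a := (j, j', f₁ * f₂)) (by simpa [hff] using hlong')) hw
      rw [ew] at this
      have a1 := ds_tri H f₁ q q2
      have a2 := ds_tri H f₁ μ'⁻¹ q
      have a3 := ds_comm H μ'⁻¹ q
      have a4 : ds len f₁ μ'⁻¹ = len (μ * f₂⁻¹) := by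
        rw [ds_comm H]; unfold ds; rw [← e3]; congr 1; group
      have a5 : len (f₁⁻¹ * q2) = ds len f₁ q2 := rfl
      have a6 := H.inv μ'
      omega
    · have := h.turnA H ha (hff ▸ ha') hlen (by rw [hff]; exact hne) (by rw [hff]; exact hne') _
        (fun x hx => ⟨sh_del H (a := (i, j, μ⁻¹ * ν)) hlong x hx,
          sh_del H (a := (i', j', f₁ * f₂)) (by simpa [hff] using hlong') x hx⟩) hw
      rw [ew] at this
      have e1 : len (μ⁻¹ * ν * q2) = ds len (μ⁻¹ * ν)⁻¹ q2 := by simp [ds]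
      have e2 := ds_tri H (μ⁻¹ * ν)⁻¹ ν⁻¹ q2
      have e3 := ds_tri H ν⁻¹ q q2
      have e4 : ds len (μ⁻¹ * ν)⁻¹ ν⁻¹ = len μ := by simp [ds, H.inv]
      have e5 := ds_comm H ν⁻¹ q
      omega

end Short
end KWP

namespace KWP

noncomputable section LocGlob

variable {G : Type*} [Group G] {len : G → ℕ} {D : ℕ}

/-- labels of reduced paths between midpoints -/
inductive GP {W : Type*} (op : W → W) (lam : W → G) (Tn : W → G → W → Prop) (F : W → Prop)
    (η : W) : G → W → Prop
  | single {h : G} {η' : W} : Tn η h η' → F η' → GP op lam Tn F η (lam η * h * (lam η')⁻¹) η'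
  | snoc {x h : G} {η' η'' : W} : GP op lam Tn F η x η' → Tn (op η') h η'' → F η'' →
      GP op lam Tn F η (x * lam (op η') * h * (lam η'')⁻¹) η''

theorem GP.mono {W : Type*} {op : W → W} {lam : W → G} {Tn : W → G → W → Prop} {F F' : W → Prop}
    {η η' : W} {x : G} (h : GP op lam Tn F η x η') (hF : ∀ w, F w → F' w) :
    GP op lam Tn F' η x η' := by
  induction h with
  | single h1 h2 => exact GP.single h1 (hF _ h2)
  | snoc _ h1 h2 ih => exact GP.snoc ih h1 (hF _ h2)

theorem GP.last {W : Type*} {op : W → W} {lam : W → G} {Tn : W → G → W → Prop} {F : W → Prop}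
    {η η' : W} {x : G} (h : GP op lam Tn F η x η') : F η' := by
  cases h with
  | single h1 h2 => exact h2
  | snoc _ h1 h2 => exact h2

theorem GP.comp {W : Type*} {op : W → W} {lam : W → G} {Tn : W → G → W → Prop} {F : W → Prop}
    {η η' η'' : W} {x y : G} (h : GP op lam Tn F η x η') (h' : GP op lam Tn F (op η') y η'') :
    GP op lam Tn F η (x * y) η'' := by
  induction h' with
  | single h1 h2 =>
    have := GP.snoc h h1 h2
    simpa [mul_assoc] using this
  | snoc _ h1 h2 ih =>
    have := GP.snoc ih h1 h2
    simpa [mul_assoc] using this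

theorem GP.ne_one (H : HypLen len D) {W : Type*} {op : W → W} {lam : W → G}
    {Tn : W → G → W → Prop} {F : W → Prop} {C T : ℕ} (hT : C + 2 * D + 1 ≤ T)
    (t1 : ∀ η h η', Tn η h η' → Tn η' h⁻¹ η)
    (t2 : ∀ η h η', Tn η h η' → ds len 1 (lam η)⁻¹ + ds len 1 (h * (lam η')⁻¹) ≤
      ds len (lam η)⁻¹ (h * (lam η')⁻¹) + 2 * C)
    (t3 : ∀ η h η', Tn η h η' → T ≤ len (lam η))
    (t4 : ∀ η h η', Tn η h η' → len (lam (op η)) + len (lam η) = len ((lam (op η))⁻¹ * lam η))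
    {η η' : W} {x : G} (h : GP op lam Tn F η x η') : x ≠ 1 := by
  have tb : ∀ η h η' b, Tn η h η' → ds len b (b * (lam η)⁻¹) + ds len b (b * h * (lam η')⁻¹) ≤
      ds len (b * (lam η)⁻¹) (b * h * (lam η')⁻¹) + 2 * C := by
    intro η h η' b ht
    have := t2 η h η' ht
    rw [← ds_left b 1 (lam η)⁻¹, ← ds_left b 1 (h * _), ← ds_left b (lam η)⁻¹] at this
    simpa [mul_assoc] using this
  have arr : ∀ η h η' b y, Tn η h η' → y = b * h * (lam η')⁻¹ →
      T ≤ ds len (b * h) y ∧ ds len (b * h) y + ds len y (y * lam (op η')) =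
        ds len (b * h) (y * lam (op η')) := by
    intro η h η' b y ht hy
    subst hy
    have ht' := t1 _ _ _ ht
    have a1 : ds len (b * h) (b * h * (lam η')⁻¹) = len (lam η') := by
      rw [← H.inv (lam η')]; unfold ds; congr 1; group
    have a2 : ds len (b * h * (lam η')⁻¹) (b * h * (lam η')⁻¹ * lam (op η')) = len (lam (op η')) := by
      unfold ds; congr 1; group
    have a3 : ds len (b * h) (b * h * (lam η')⁻¹ * lam (op η')) =
        len ((lam (op η'))⁻¹ * lam η') := by
      rw [ds_comm H]; unfold ds; congr 1; group
    have := t3 _ _ _ ht'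
    have := t4 _ _ _ ht'
    omega
  have main : ds len 1 x + ds len x (x * lam (op η')) ≤ ds len 1 (x * lam (op η')) + D ∧
      0 < ds len 1 x := by
    induction h with
    | @single h η' ht hF =>
      have ht' := t1 _ _ _ ht
      obtain ⟨a1, a2⟩ := arr η h η' (lam η) _ ht rfl
      set y := lam η * h * (lam η')⁻¹ with hy
      have b2 := tb _ _ _ (lam η * h) ht'
      have e1 : lam η * h * h⁻¹ * (lam η)⁻¹ = 1 := by group
      rw [e1, ← hy] at b2
      have c1 := ds_comm H y (1 : G)
      have c2 := ds_comm H (lam η * h) 1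
      have c3 := ds_comm H (lam η * h) y
      have f := ds_four H 1 (lam η * h) (y * lam (op η')) y
      have f1 := ds_four H 1 (lam η * h) y (y * lam (op η'))
      have g1 := ds_tri H (lam η * h) 1 y
      have c4 := ds_comm H (y * lam (op η')) y
      omega
    | @snoc x h η' η'' hg ht hF ih =>
      have ht' := t1 _ _ _ ht
      obtain ⟨i1, i2⟩ := ih
      set b := x * lam (op η') with hb
      obtain ⟨a1, a2⟩ := arr _ h η'' b _ ht rfl
      set y := b * h * (lam η'')⁻¹ with hy
      set z := y * lam (op η'') with hz
      set v := b * h with hv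
      have b1 := tb _ _ _ b ht
      have e0 : b * (lam (op η'))⁻¹ = x := by rw [hb]; group
      rw [e0, ← hv, ← hy] at b1
      have b2 := tb _ _ _ v ht'
      have e1 : v * h⁻¹ * (lam (op η'))⁻¹ = x := by rw [hv, hb]; group
      rw [e1, ← hy] at b2
      have l1 := t3 _ _ _ ht
      have l2 : ds len x b = len (lam (op η')) := by simp [ds, hb]
      have c1 := ds_comm H y x
      have c2 := ds_comm H v x
      have c3 := ds_comm H v y
      have c4 := ds_comm H z y
      have c5 := ds_comm H b x
      have f1 : ds len 1 x + ds len x y ≤ ds len 1 y + 2 * D := by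
        have f := ds_four H 1 b y x
        have f' := ds_four H 1 y b x
        have := ds_comm H b y
        have g1 := ds_tri H x b y
        have := ds_four H 1 b x y
        omega
      have f2 : ds len 1 y + ds len y v + 2 * C + 1 ≥ ds len 1 v := by
        have := ds_tri H 1 y v
        omega
      have g1 := ds_tri H b x y
      have g2 := ds_tri H v x y
      have f3 : 2 * T + ds len 1 v ≤ ds len 1 y + ds len y v + 2 * C + 3 * D := by
        have := ds_four H 1 x v y
        have := ds_four H 1 v x y
        omega
      have g3 := ds_tri H v 1 y
      have c6 := ds_comm H v 1
      have c7 := ds_comm H y 1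
      have := ds_four H 1 v z y
      have := ds_four H 1 z v y
      have := ds_four H 1 v y z
      have := ds_comm H v z
      omega
  intro h1
  rw [h1, ds_self H] at main
  omega

end LocGlob
end KWP

namespace KWP

noncomputable section Normal

open Classical

variable {G : Type*} [Group G] {len : G → ℕ} {D : ℕ}
variable {U : Subgroup G} {l : ℕ} {V : Finset ℕ} {E : Finset (Arc G)}

/-- half arcs -/
abbrev HA (G : Type*) := Arc G × Bool

def op (η : HA G) : HA G := (η.1, !η.2)

def lam (hf : G → G) (η : HA G) : G := if η.2 then (hf η.1.2.2)⁻¹ * η.1.2.2 else (hf η.1.2.2)⁻¹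

def vt (η : HA G) : ℕ := if η.2 then η.1.2.1 else η.1.1

/-- reduced turns -/
def Tn (len : G → ℕ) (r : ℕ) (E : Finset (Arc G)) (η : HA G) (h : G) (η' : HA G) : Prop :=
  (η.1 ∈ E ∧ r < len η.1.2.2) ∧ (η'.1 ∈ E ∧ r < len η'.1.2.2) ∧
    Rch (sh len r E : Set (Arc G)) (vt η) (vt η') h ∧ (η = η' → h ≠ 1)

@[simp] theorem op_op (η : HA G) : op (op η) = η := by simp [op]

theorem half_OE (hf : G → G) {η : HA G} (hη : η.1 ∈ E) :
    OE E (vt (op η), vt η, (lam hf (op η))⁻¹ * lam hf η) := by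
  obtain ⟨⟨i, j, g⟩, b⟩ := η
  cases b
  · right; simpa [rev, op, lam, vt] using hη
  · left; simpa [rev, op, lam, vt] using hη

theorem half_eq (hf : G → G) (η : HA G) :
    (vt (op η), vt η, (lam hf (op η))⁻¹ * lam hf η) = η.1 ∨
    rev (vt (op η), vt η, (lam hf (op η))⁻¹ * lam hf η) = η.1 := by
  obtain ⟨⟨i, j, g⟩, b⟩ := η
  cases b
  · right; simp [rev, op, lam, vt]
  · left; simp [op, lam, vt]

theorem half_len (H : HypLen len D) {hf : G → G}
    (hhf : ∀ g, len (hf g) = len g / 2 ∧ len ((hf g)⁻¹ * g) + len g / 2 = len g) (η : HA G) :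
    len (lam hf (op η)) + len (lam hf η) = len ((lam hf (op η))⁻¹ * lam hf η) ∧
    len ((lam hf (op η))⁻¹ * lam hf η) = len η.1.2.2 ∧ len η.1.2.2 / 2 ≤ len (lam hf η) := by
  obtain ⟨⟨i, j, g⟩, b⟩ := η
  have h1 := hhf g
  have h2 := H.inv (hf g)
  have h3 := H.inv g
  cases b
  · have e : (lam hf (op ((i, j, g), false)))⁻¹ * lam hf ((i, j, g), false) = g⁻¹ := by
      simp [op, lam]
    rw [e]
    simp [op, lam]
    omega
  · have e : (lam hf (op ((i, j, g), true)))⁻¹ * lam hf ((i, j, g), true) = g := by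
      simp [op, lam]
    rw [e]
    simp [op, lam]
    omega

theorem Tn.symm {r : ℕ} {η η' : HA G} {h : G} (ht : Tn len r E η h η') : Tn len r E η' h⁻¹ η := by
  obtain ⟨a, b, c, d⟩ := ht
  refine ⟨b, a, c.symm, fun e => ?_⟩
  rw [ne_eq, inv_eq_one]
  exact d e.symm

theorem gp_ne_one (H : HypLen len D) (h : MinCfg len U l V E) {r B D1 : ℕ}
    (hG : ∀ j ∈ V, Good len (9 * D) B (vgrp (sh len r E : Set (Arc G)) j))
    (hD1 : ∀ i ∈ V, ∀ j g, Rch (sh len r E : Set (Arc G)) i j g →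
      ∃ c, Rch (sh len r E : Set (Arc G)) i j c ∧ len c ≤ D1)
    {hf : G → G}
    (hhf : ∀ g, len (hf g) = len g / 2 ∧ len ((hf g)⁻¹ * g) + len g / 2 = len g)
    (hgap : ∀ a ∈ E, r < len a.2.2 → 2 * (8 * D + B + D1 + 3) ≤ len a.2.2)
    {F : HA G → Prop} {η η' : HA G} {x : G} (hx : GP op (lam hf) (Tn len r E) F η x η') :
    x ≠ 1 := by
  refine GP.ne_one H (C := 6 * D + B + D1 + 2) (T := 8 * D + B + D1 + 3) (by omega)
    (fun _ _ _ => Tn.symm) ?_ ?_ ?_ hx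
  · intro η w η' ht
    obtain ⟨a, b, c, d⟩ := ht
    have l1 := half_len H hhf η
    have l2 := half_len H hhf η'
    refine turn H h hG hD1 (half_OE hf a.1) l1.1 (by omega) (half_OE hf b.1) l2.1 (by omega) c ?_
    by_cases he : η.1 = η'.1
    · by_cases hb : η.2 = η'.2
      · have : η = η' := Prod.ext he hb
        subst this
        exact Or.inl ⟨rfl, rfl, rfl, d rfl⟩
      · have : η = op η' := by
          refine Prod.ext he ?_
          show η.2 = !η'.2
          revert hb
          cases η.2 <;> cases η'.2 <;> simp
        subst this
        right; left
        simp
    · right; right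
      have q1 := half_eq hf η
      have q2 := half_eq hf η'
      have nr : rev η.1 ≠ η'.1 := by
        intro hh
        apply he
        have := h.norev a.1 (hh ▸ b.1)
        rw [← hh, this]
      have nr' : η.1 ≠ rev η'.1 := by
        intro hh
        apply nr; rw [hh, rev_rev]
      generalize (vt (op η), vt η, (lam hf (op η))⁻¹ * lam hf η) = A at *
      generalize (vt (op η'), vt η', (lam hf (op η'))⁻¹ * lam hf η') = A' at *
      constructor
      · rintro rfl
        rcases q1 with q1 | q1 <;> rcases q2 with q2 | q2
        · exact he (q1.symm.trans q2)
        · apply nr; rw [← q1, q2]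
        · apply nr; rw [← q1, rev_rev, q2]
        · exact he (q1.symm.trans q2)
      · rintro rfl
        rw [rev_rev] at q1
        rcases q1 with q1 | q1 <;> rcases q2 with q2 | q2
        · apply nr; rw [← q1, rev_rev, q2]
        · exact he (q1.symm.trans q2)
        · exact he (q1.symm.trans q2)
        · apply nr; rw [← q1, q2]
  · intro η w η' ht
    have l1 := half_len H hhf η
    have := hgap _ ht.1.1 ht.1.2
    omega
  · intro η w η' ht
    exact (half_len H hhf η).1

/-- normal form of paths avoiding the arc `e` -/
def NF (len : G → ℕ) (hf : G → G) (r : ℕ) (E : Finset (Arc G)) (e : Arc G) (η : HA G) (k : ℕ)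
    (y : G) : Prop :=
  Rch (sh len r E : Set (Arc G)) (vt η) k y ∨
  ∃ η1 x h, GP op (lam hf) (Tn len r E) (fun w => w.1 ≠ e) η x η1 ∧ (η1.1 ∈ E ∧ r < len η1.1.2.2) ∧
    Rch (sh len r E : Set (Arc G)) (vt (op η1)) k h ∧ y = (lam hf η)⁻¹ * x * lam hf (op η1) * h

theorem NF.short {hf : G → G} {r : ℕ} {e : Arc G} {η : HA G} {k k' : ℕ} {y s : G}
    (h : NF len hf r E e η k y) (hs : Rch (sh len r E : Set (Arc G)) k k' s) :
    NF len hf r E e η k' (y * s) := by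
  rcases h with h | ⟨η1, x, w, hg, hl, hw, rfl⟩
  · exact Or.inl (h.trans hs)
  · exact Or.inr ⟨η1, x, w * s, hg, hl, hw.trans hs, by group⟩

theorem NF.long {hf : G → G} {r : ℕ} {e : Arc G} {η : HA G} (hη : η.1 = e)
    (he : e ∈ E ∧ r < len e.2.2) {y : G} {η2 : HA G}
    (h : NF len hf r E e η (vt η2) y) (hl2 : η2.1 ∈ E ∧ r < len η2.1.2.2) (hn : η2.1 ≠ e) :
    NF len hf r E e η (vt (op η2)) (y * ((lam hf η2)⁻¹ * lam hf (op η2))) := by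
  rcases h with h | ⟨η1, x, w, hg, hl, hw, rfl⟩
  · refine Or.inr ⟨η2, _, 1, GP.single (h := y) ⟨hη ▸ he, hl2, h, ?_⟩ hn, hl2, Rch.refl _, by group⟩
    rintro rfl; exact absurd hη hn
  · by_cases hc : op η1 = η2 ∧ w = 1
    · obtain ⟨rfl, rfl⟩ := hc
      rw [op_op]
      cases hg with
      | @single h0 _ ht hF =>
        left
        refine ht.2.2.1.cast ?_
        group
      | @snoc x0 h0 η0 _ hg ht hF =>
        right
        exact ⟨η0, x0, h0, hg, ht.1, ht.2.2.1, by group⟩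
    · refine Or.inr ⟨η2, _, 1, GP.snoc (h := w) hg ⟨hl, hl2, hw, fun e1 e2 => hc ⟨e1, e2⟩⟩ hn,
        hl2, Rch.refl _, by group⟩

theorem nf_all (H : HypLen len D) {hf : G → G} {r : ℕ} {e : Arc G} {η : HA G} (hη : η.1 = e)
    (he : e ∈ E ∧ r < len e.2.2) {k : ℕ} {y : G}
    (h : Rch (E.erase e : Set (Arc G)) (vt η) k y) : NF len hf r E e η k y := by
  generalize hj : vt η = j at h
  induction h with
  | refl => left; rw [hj]; exact Rch.refl _
  | @fwd j k g a hr hm ih =>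
    have hm' := Finset.mem_erase.1 (Finset.mem_coe.1 hm)
    by_cases hs : len a ≤ r
    · exact ih.short (Rch.arc (Finset.mem_coe.2 (mem_sh.2 ⟨hm'.2, hs⟩)))
    · have := NF.long hη he (η2 := ((j, k, a), false)) (hf := hf) (y := g)
        (by simpa [vt] using ih) ⟨hm'.2, by simpa using hs⟩ hm'.1
      simpa [vt, op, lam] using this
  | @bwd j k g a hr hm ih =>
    have hm' := Finset.mem_erase.1 (Finset.mem_coe.1 hm)
    by_cases hs : len a ≤ r
    · exact ih.short (Rch.rarc (Finset.mem_coe.2 (mem_sh.2 ⟨hm'.2, hs⟩)))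
    · have := NF.long hη he (η2 := ((k, j, a), true)) (hf := hf) (y := g)
        (by simpa [vt] using ih) ⟨hm'.2, by simpa using hs⟩ hm'.1
      simpa [vt, op, lam] using this

theorem nf_final (H : HypLen len D) {hf : G → G} {r : ℕ} {e : Arc G} {η η' : HA G} (hη : η.1 = e)
    (hη' : η'.1 = e) (he : e ∈ E ∧ r < len e.2.2) {y : G}
    (h : Rch (E.erase e : Set (Arc G)) (vt η) (vt η') y) (hy : η = η' → y ≠ 1) :
    GP op (lam hf) (Tn len r E) (fun _ => True) η (lam hf η * y * (lam hf η')⁻¹) η' := by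
  rcases nf_all H (hf := hf) hη he h with h | ⟨η1, x, w, hg, hl, hw, rfl⟩
  · exact GP.single ⟨hη ▸ he, hη' ▸ he, h, hy⟩ trivial
  · have := GP.snoc (h := w) (η'' := η') (hg.mono (F' := fun _ => True) (fun _ _ => trivial))
      ⟨hl, hη' ▸ he, hw, fun e1 => ?_⟩ trivial
    · have e1 : lam hf η * ((lam hf η)⁻¹ * x * lam hf (op η1) * w) * (lam hf η')⁻¹ =
        x * lam hf (op η1) * w * (lam hf η')⁻¹ := by group
      rw [e1]; exact this
    · exact absurd (by rw [← hη', ← e1]; rfl : η1.1 = e) hg.last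

/-- package for the free splitting -/
theorem pack (H : HypLen len D) (h : MinCfg len U l V E) {r B D1 : ℕ}
    (hG : ∀ j ∈ V, Good len (9 * D) B (vgrp (sh len r E : Set (Arc G)) j))
    (hD1 : ∀ i ∈ V, ∀ j g, Rch (sh len r E : Set (Arc G)) i j g →
      ∃ c, Rch (sh len r E : Set (Arc G)) i j c ∧ len c ≤ D1)
    (hgap : ∀ a ∈ E, r < len a.2.2 → 2 * (8 * D + B + D1 + 3) ≤ len a.2.2)
    {i j : ℕ} {g : G} (he : (i, j, g) ∈ E) (hl : r < len g) :
    ∃ (lm : Bool → G) (X : Bool → G → Bool → Prop),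
      (lm false)⁻¹ * lm true = g ∧
      (∀ b x b' y b'', X b x b' → X (!b') y b'' → X b (x * y) b'') ∧
      (∀ b x b', X b x b' → x ≠ 1) ∧
      (∀ b y b', Rch (E.erase (i, j, g) : Set (Arc G)) (if b then j else i) (if b' then j else i) y →
        (b = b' → y ≠ 1) → X b (lm b * y * (lm b')⁻¹) b') := by
  have hs : ∀ g, ∃ a, len a = len g / 2 ∧ len (a⁻¹ * g) + len g / 2 = len g := by
    intro g
    obtain ⟨a, b, hab, h1, h2⟩ := H.split g (len g / 2) (by omega)
    refine ⟨a, h1, ?_⟩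
    rw [← hab, inv_mul_cancel_left, hab]; exact h2
  choose hf hhf using hs
  refine ⟨fun b => lam hf ((i, j, g), b),
    fun b x b' => GP op (lam hf) (Tn len r E) (fun _ => True) ((i, j, g), b) x ((i, j, g), b'),
    by simp [lam], ?_, ?_, ?_⟩
  · intro b x b' y b'' h1 h2
    exact GP.comp h1 h2
  · intro b x b' h1
    exact gp_ne_one H h hG hD1 hhf hgap h1
  · intro b y b' hr hne
    exact nf_final H (η := ((i, j, g), b)) (η' := ((i, j, g), b')) rfl rfl ⟨he, hl⟩ hr
      (fun e => hne (by simpa using e))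

end Normal
end KWP

namespace KWP

noncomputable section Split

open Classical

inductive Sg {M : Type*} [Group M] (S : Bool → Bool → M → Prop) : Bool → M → Prop
  | one {b b' : Bool} {x : M} : S b b' x → (b = b' → x ≠ 1) → Sg S b x
  | cons {b b' : Bool} {x z : M} : S b b' x → (b = b' → x ≠ 1) → Sg S (!b') z → Sg S b (x * z)

theorem Sg.mulS {M : Type*} [Group M] {S : Bool → Bool → M → Prop}
    (hcomp : ∀ b b' b'' x y, S b b' x → S b' b'' y → S b b'' (x * y))
    {b b' : Bool} {x z : M} (hx : S b b' x) (hz : z = 1 ∨ ∃ c, Sg S c z) :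
    x * z = 1 ∨ ∃ c, Sg S c (x * z) := by
  have base : ∀ {b b' : Bool} {x : M}, S b b' x → x = 1 ∨ ∃ c, Sg S c x := by
    intro b b' x hx
    by_cases h : x = 1
    · exact Or.inl h
    · exact Or.inr ⟨b, Sg.one hx fun _ => h⟩
  rcases hz with rfl | ⟨c, hc⟩
  · rw [mul_one]; exact base hx
  · by_cases e : c = b'
    · subst e
      cases hc with
      | one hy hne => exact base (hcomp _ _ _ _ _ hx hy)
      | @cons _ b2 y z' hy hne hz' =>
        rw [← mul_assoc]
        by_cases h : b = b2 → x * y ≠ 1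
        · exact Or.inr ⟨b, Sg.cons (hcomp _ _ _ _ _ hx hy) h hz'⟩
        · push Not at h
          rw [h.2, one_mul]
          exact Or.inr ⟨_, hz'⟩
    · have e' : c = !b' := by cases c <;> cases b' <;> simp_all
      subst e'
      by_cases h : b = b' → x ≠ 1
      · exact Or.inr ⟨b, Sg.cons hx h hc⟩
      · push Not at h
        rw [h.2, one_mul]
        exact Or.inr ⟨_, hc⟩

theorem inj_of_seg {M G : Type*} [Group M] [Group G] (θ : M →* G)
    {S : Bool → Bool → M → Prop} {X : Bool → G → Bool → Prop}
    (hcomp : ∀ b b' b'' x y, S b b' x → S b' b'' y → S b b'' (x * y))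
    (hX : ∀ b x b' y b'', X b x b' → X (!b') y b'' → X b (x * y) b'')
    (hne : ∀ b x b', X b x b' → x ≠ 1)
    (hSX : ∀ b b' x, S b b' x → (b = b' → x ≠ 1) → X b (θ x) b')
    (ind : ∀ C : M → Prop, C 1 → (∀ b b' x z, S b b' x → C z → C (x * z)) → ∀ z, C z) :
    Function.Injective θ := by
  rw [injective_iff_map_eq_one]
  intro z hz
  have hok := ind (fun z => z = 1 ∨ ∃ c, Sg S c z) (Or.inl rfl)
    (fun b b' x z hx hz => Sg.mulS hcomp hx hz) z
  rcases hok with h | ⟨c, hc⟩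
  · exact h
  · exfalso
    have : ∀ c z, Sg S c z → ∃ b', X c (θ z) b' := by
      intro c z h
      induction h with
      | one hx hn => exact ⟨_, hSX _ _ _ hx hn⟩
      | cons hx hn _ ih =>
        obtain ⟨b2, h2⟩ := ih
        refine ⟨b2, ?_⟩
        rw [map_mul]
        exact hX _ _ _ _ _ (hSX _ _ _ hx hn) h2
    obtain ⟨b', hb⟩ := this c z hc
    exact hne _ _ _ hb hz

open Monoid in
theorem split_contra {P Q G : Type*} [Group P] [Group Q] [Group G] [Nontrivial P] [Nontrivial Q]
    (f : P →* G) (k : Q →* G) (hinj : Function.Injective (Coprod.lift f k))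
    (U : Subgroup G) (d : G) (hd : ∀ x, x ∈ (Coprod.lift f k).range ↔ d * x * d⁻¹ ∈ U) :
    ∃ A B : Subgroup U, A ≠ ⊥ ∧ B ≠ ⊥ ∧
        Function.Bijective (Coprod.lift A.subtype B.subtype) := by
  set θ := Coprod.lift f k with hθ
  let Θ : Coprod P Q →* U := ((MulAut.conj d).toMonoidHom.comp θ).codRestrict U (by
    intro x
    have := (hd (θ x)).1 ⟨x, rfl⟩
    simpa using this)
  have Θv : ∀ x, (Θ x : G) = d * θ x * d⁻¹ := fun x => by simp [Θ]
  have Θi : Function.Injective Θ := by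
    intro x y h
    have h' := congrArg (Subtype.val) h
    rw [Θv, Θv] at h'
    apply hinj
    simpa using h'
  have Θs : Function.Surjective Θ := by
    rintro ⟨u, hu⟩
    obtain ⟨x, hx⟩ := (hd (d⁻¹ * u * d)).2 (by simpa [mul_assoc] using hu)
    refine ⟨x, Subtype.ext ?_⟩
    rw [Θv, hx]; simp [mul_assoc]
  have i1 : Function.Injective (Θ.comp (Coprod.inl : P →* Coprod P Q)) :=
    Θi.comp Coprod.inl_injective
  have i2 : Function.Injective (Θ.comp (Coprod.inr : Q →* Coprod P Q)) :=
    Θi.comp Coprod.inr_injective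
  refine ⟨(Θ.comp Coprod.inl).range, (Θ.comp Coprod.inr).range, ?_, ?_, ?_⟩
  · obtain ⟨p, hp⟩ := exists_ne (1 : P)
    intro h
    have hm : (Θ.comp Coprod.inl) p ∈ (Θ.comp Coprod.inl).range := ⟨p, rfl⟩
    rw [h, Subgroup.mem_bot] at hm
    exact hp (i1 (by rw [hm, map_one]))
  · obtain ⟨p, hp⟩ := exists_ne (1 : Q)
    intro h
    have hm : (Θ.comp Coprod.inr) p ∈ (Θ.comp Coprod.inr).range := ⟨p, rfl⟩
    rw [h, Subgroup.mem_bot] at hm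
    exact hp (i2 (by rw [hm, map_one]))
  · set A := (Θ.comp (Coprod.inl : P →* Coprod P Q)).range
    set B := (Θ.comp (Coprod.inr : Q →* Coprod P Q)).range
    let e : Coprod P Q ≃* Coprod A B := MulEquiv.coprodCongr (MonoidHom.ofInjective i1)
      (MonoidHom.ofInjective i2)
    have he : (Coprod.lift A.subtype B.subtype).comp e.toMonoidHom = Θ := by
      apply Coprod.hom_ext
      · ext p; rfl
      · ext p; rfl
    have hfun : ⇑(Coprod.lift A.subtype B.subtype) ∘ ⇑e = ⇑Θ := by
      rw [← he]; rfl
    rw [← e.bijective.of_comp_iff, hfun]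
    exact ⟨Θi, Θs⟩

end Split
end KWP

namespace KWP

noncomputable section Fin

open Classical

variable {G : Type*} [Group G] {len : G → ℕ} {D : ℕ}
variable {U : Subgroup G} {l : ℕ} {V : Finset ℕ} {E : Finset (Arc G)}

theorem gen_mem {E0 E : Set (Arc G)} {i j : ℕ} {g : G} {lm : Bool → G} (hlm : (lm false)⁻¹ * lm true = g)
    (hE : ∀ a ∈ E, a = (i, j, g) ∨ a ∈ E0) (R : Subgroup G)
    (hR : ∀ b b' p, Rch E0 (if b then j else i) (if b' then j else i) p → lm b * p * (lm b')⁻¹ ∈ R)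
    {x : G} (hx : Rch E i i x) : lm false * x * (lm false)⁻¹ ∈ R := by
  have hg : lm true = lm false * g := by rw [← hlm]; group
  have claim : ∀ k x, Rch E i k x → ∃ (b : Bool) (p : G), Rch E0 (if b then j else i) k p ∧
      lm false * x * p⁻¹ * (lm b)⁻¹ ∈ R := by
    intro k x h
    induction h with
    | refl => exact ⟨false, 1, by simpa using Rch.refl _, by simp [R.one_mem]⟩
    | @fwd z w x a hr hm ih =>
      obtain ⟨b, p, h1, h2⟩ := ih
      rcases hE _ hm with h | h
      · simp only [Prod.mk.injEq] at h
        obtain ⟨rfl, rfl, rfl⟩ := h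
        refine ⟨true, 1, by simpa using Rch.refl _, ?_⟩
        have := R.mul_mem h2 (hR b false p (by simpa using h1))
        convert this using 1
        rw [hg]; group
      · refine ⟨b, p * a, h1.fwd h, ?_⟩
        convert h2 using 1
        group
    | @bwd z w x a hr hm ih =>
      obtain ⟨b, p, h1, h2⟩ := ih
      rcases hE _ hm with h | h
      · simp only [Prod.mk.injEq] at h
        obtain ⟨rfl, rfl, rfl⟩ := h
        refine ⟨false, 1, by simpa using Rch.refl _, ?_⟩
        have := R.mul_mem h2 (hR b true p (by simpa using h1))
        convert this using 1
        rw [hg]; group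
      · refine ⟨b, p * a⁻¹, h1.bwd h, ?_⟩
        convert h2 using 1
        group
  obtain ⟨b, p, h1, h2⟩ := claim _ _ hx
  have := R.mul_mem h2 (hR b false p (by simpa using h1))
  convert this using 1
  group

theorem gen_back {E0 E : Set (Arc G)} {i j : ℕ} {g : G} {lm : Bool → G} (hlm : (lm false)⁻¹ * lm true = g)
    (he : (i, j, g) ∈ E) (hs : E0 ⊆ E) {b b' : Bool} {p : G}
    (hp : Rch E0 (if b then j else i) (if b' then j else i) p) :
    Rch E i i ((lm false)⁻¹ * (lm b * p * (lm b')⁻¹) * lm false) := by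
  have h1 : ∀ b : Bool, Rch E i (if b then j else i) ((lm false)⁻¹ * lm b) := by
    intro b
    cases b
    · simpa using Rch.refl _
    · simpa [hlm] using Rch.arc he
  exact (((h1 b).trans (hp.mono hs)).trans (h1 b').symm).cast (by group)

theorem triv_sep {E0 E : Set (Arc G)} {i j : ℕ} {γ : G}
    (hE : ∀ z w a, (z, w, a) ∈ E → (z, w, a) ∈ E0 ∨ (z = i ∧ w = j ∧ a = γ) ∨ (z = j ∧ w = i ∧ a = γ⁻¹))
    (hn : ∀ p, ¬ Rch E0 j i p) (ht : ∀ p, Rch E0 i i p → p = 1) {x : G} (hx : Rch E j j x) :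
    Rch E0 j j x := by
  let C : ℕ → G → Prop := fun k x => Rch E0 j k x ∨ ∃ p, Rch E0 i k p ∧ Rch E0 j j (x * p⁻¹ * γ)
  have s1 : ∀ x, C i x → C j (x * γ) := by
    rintro x (h | ⟨p, h1, h2⟩)
    · exact (hn _ h).elim
    · obtain rfl := ht p h1
      left; simpa using h2
  have s2 : ∀ x, C j x → C i (x * γ⁻¹) := by
    rintro x (h | ⟨p, h1, h2⟩)
    · right; exact ⟨1, Rch.refl _, by simpa using h⟩
    · exact (hn _ h1.symm).elim
  have claim : ∀ k x, Rch E j k x → C k x := by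
    intro k x h
    induction h with
    | refl => left; exact Rch.refl _
    | @fwd z w x a hr hm ih =>
      rcases hE _ _ _ hm with h | ⟨rfl, rfl, rfl⟩ | ⟨rfl, rfl, rfl⟩
      · rcases ih with h' | ⟨p, h1, h2⟩
        · left; exact h'.fwd h
        · right; exact ⟨p * a, h1.fwd h, h2.cast (by group)⟩
      · exact s1 _ ih
      · exact s2 _ ih
    | @bwd z w x a hr hm ih =>
      rcases hE _ _ _ hm with h | ⟨rfl, rfl, rfl⟩ | ⟨rfl, rfl, rfl⟩
      · rcases ih with h' | ⟨p, h1, h2⟩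
        · left; exact h'.bwd h
        · right; exact ⟨p * a⁻¹, h1.bwd h, h2.cast (by group)⟩
      · exact s2 _ ih
      · rw [inv_inv]; exact s1 _ ih
  rcases claim _ _ hx with h | ⟨p, h1, h2⟩
  · exact h
  · exact (hn _ h1.symm).elim

theorem triv_cfg (H : HypLen len D) (h : MinCfg len U l V E) {i j : ℕ} {g : G} (he : (i, j, g) ∈ E)
    (hg : 0 < len g) (v : ℕ) (hv : v ∈ V)
    (hsame : ∀ x, Rch (E : Set (Arc G)) v v x ↔
      Rch ((insert (i, j, 1) (E.erase (i, j, g)) : Finset (Arc G)) : Set (Arc G)) v v x) : False := by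
  set E' := insert (i, j, (1 : G)) (E.erase (i, j, g)) with hE'
  have hc : Cfg U l V E' := by
    refine ⟨?_, ?_, ?_, ?_⟩
    · intro a ha
      rcases Finset.mem_insert.1 ha with rfl | ha
      · exact h.1.ends (i, j, g) he
      · exact h.1.ends _ (Finset.mem_of_mem_erase ha)
    · intro a ha b hb
      obtain ⟨x, hx⟩ := h.1.conn a ha b hb
      have : ∀ a b x, Rch (E : Set (Arc G)) a b x → ∃ y, Rch (E' : Set (Arc G)) a b y := by
        intro a b x hx
        have harc : ∀ z w t, (z, w, t) ∈ E → ∃ s, (z, w, s) ∈ (E' : Set (Arc G)) := by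
          intro z w t ht
          by_cases e : (z, w, t) = (i, j, g)
          · simp only [Prod.mk.injEq] at e
            obtain ⟨rfl, rfl, rfl⟩ := e
            exact ⟨1, by simp [hE']⟩
          · refine ⟨t, Finset.mem_coe.2 (Finset.mem_insert_of_mem (Finset.mem_erase.2 ⟨e, ht⟩))⟩
        induction hx with
        | refl => exact ⟨1, Rch.refl _⟩
        | fwd _ hm ih =>
          obtain ⟨y, hy⟩ := ih
          obtain ⟨s, hs⟩ := harc _ _ _ hm
          exact ⟨_, hy.fwd hs⟩
        | bwd _ hm ih =>
          obtain ⟨y, hy⟩ := ih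
          obtain ⟨s, hs⟩ := harc _ _ _ hm
          exact ⟨_, hy.bwd hs⟩
      exact this a b x hx
    · have h1 := h.1.card
      have h2 := Finset.card_insert_le (i, j, (1 : G)) (E.erase (i, j, g))
      have h3 := Finset.card_erase_add_one he
      rw [← hE'] at h2
      omega
    · obtain ⟨c, hc⟩ := h.1.all v hv
      exact ⟨v, hv, c, fun x => by rw [← hsame, hc]⟩
  have h1 := h.2 _ _ hc
  have h2 := cost_insert (len := len) (i, j, (1 : G)) (E.erase (i, j, g))
  have h3 := cost_sub (len := len) (Finset.erase_subset (i, j, g) E) he (by simp)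
  simp only [H.one] at h2
  simp only at h3
  rw [← hE'] at h2
  omega

theorem triv_contra (H : HypLen len D) (h : MinCfg len U l V E) {i j : ℕ} {g : G} (he : (i, j, g) ∈ E)
    (hg : 0 < len g) (hn : ∀ p, ¬ Rch (E.erase (i, j, g) : Set (Arc G)) j i p)
    (ht : (∀ p, Rch (E.erase (i, j, g) : Set (Arc G)) i i p → p = 1) ∨
      (∀ p, Rch (E.erase (i, j, g) : Set (Arc G)) j j p → p = 1)) : False := by
  have hsub : ((E.erase (i, j, g) : Finset (Arc G)) : Set (Arc G)) ⊆ (E : Set (Arc G)) := by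
    intro a ha; exact Finset.mem_of_mem_erase (Finset.mem_coe.1 ha)
  have hsub' : ((E.erase (i, j, g) : Finset (Arc G)) : Set (Arc G)) ⊆
      ((insert (i, j, 1) (E.erase (i, j, g)) : Finset (Arc G)) : Set (Arc G)) := by
    intro a ha; exact Finset.mem_coe.2 (Finset.mem_insert_of_mem (Finset.mem_coe.1 ha))
  have a1 : ∀ z w a, (z, w, a) ∈ (E : Set (Arc G)) →
      (z, w, a) ∈ ((E.erase (i, j, g) : Finset (Arc G)) : Set (Arc G)) ∨ (z = i ∧ w = j ∧ a = g) := by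
    intro z w a hm
    by_cases e : (z, w, a) = (i, j, g)
    · right; simpa using e
    · left; exact Finset.mem_coe.2 (Finset.mem_erase.2 ⟨e, hm⟩)
  have a2 : ∀ z w a, (z, w, a) ∈ ((insert (i, j, 1) (E.erase (i, j, g)) : Finset (Arc G)) : Set (Arc G)) →
      (z, w, a) ∈ ((E.erase (i, j, g) : Finset (Arc G)) : Set (Arc G)) ∨ (z = i ∧ w = j ∧ a = 1) := by
    intro z w a hm
    rcases Finset.mem_insert.1 (Finset.mem_coe.1 hm) with e | e
    · right; simpa using e
    · left; exact Finset.mem_coe.2 e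
  rcases ht with ht | ht
  · refine triv_cfg H h he hg j (h.1.ends _ he).2 fun x => ⟨fun hx => ?_, fun hx => ?_⟩
    · exact (triv_sep (γ := g) (fun z w a hm => (a1 z w a hm).imp id Or.inl) hn ht hx).mono hsub'
    · exact (triv_sep (γ := 1) (fun z w a hm => (a2 z w a hm).imp id Or.inl) hn ht hx).mono hsub
  · have hn' : ∀ p, ¬ Rch (E.erase (i, j, g) : Set (Arc G)) i j p := fun p hp => hn _ hp.symm
    refine triv_cfg H h he hg i (h.1.ends _ he).1 fun x => ⟨fun hx => ?_, fun hx => ?_⟩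
    · exact (triv_sep (γ := g⁻¹) (fun z w a hm => (a1 z w a hm).imp id
        (fun k => Or.inr ⟨k.1, k.2.1, by rw [inv_inv]; exact k.2.2⟩)) hn' ht hx).mono hsub'
    · exact (triv_sep (γ := 1) (fun z w a hm => (a2 z w a hm).imp id
        (fun k => Or.inr ⟨k.1, k.2.1, by rw [inv_one]; exact k.2.2⟩)) hn' ht hx).mono hsub

end Fin
end KWP

namespace KWP

noncomputable section NoLong

open Classical Monoid

variable {G : Type*} [Group G] {len : G → ℕ} {D : ℕ}
variable {U : Subgroup G} {l : ℕ} {V : Finset ℕ} {E : Finset (Arc G)}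

/-- conjugated inclusion -/
def cj (d : G) (K : Subgroup G) : K →* G := (MulAut.conj d).toMonoidHom.comp K.subtype

@[simp] theorem cj_apply (d : G) (K : Subgroup G) (x : K) : cj d K x = d * x * d⁻¹ := rfl

theorem no_long (H : HypLen len D) (h : MinCfg len U l V E) {r B D1 : ℕ}
    (hG : ∀ j ∈ V, Good len (9 * D) B (vgrp (sh len r E : Set (Arc G)) j))
    (hD1 : ∀ i ∈ V, ∀ j g, Rch (sh len r E : Set (Arc G)) i j g →
      ∃ c, Rch (sh len r E : Set (Arc G)) i j c ∧ len c ≤ D1)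
    (hgap : ∀ a ∈ E, r < len a.2.2 → 2 * (8 * D + B + D1 + 3) ≤ len a.2.2)
    (hns : ¬ ∃ A B : Subgroup U, A ≠ ⊥ ∧ B ≠ ⊥ ∧
        Function.Bijective (Coprod.lift A.subtype B.subtype))
    (hnc : ¬ IsCyclic U)
    {i j : ℕ} {g : G} (he : (i, j, g) ∈ E) (hl : r < len g) : False := by
  obtain ⟨lm, X, hlm, hX, hne, hR⟩ := pack H h hG hD1 hgap he hl
  obtain ⟨c, hc⟩ := h.1.all i (h.1.ends _ he).1
  set E0 : Set (Arc G) := ((E.erase (i, j, g) : Finset (Arc G)) : Set (Arc G)) with hE0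
  have hsub : E0 ⊆ (E : Set (Arc G)) := by
    intro a ha; exact Finset.mem_of_mem_erase (Finset.mem_coe.1 ha)
  have hEE : ∀ a ∈ (E : Set (Arc G)), a = (i, j, g) ∨ a ∈ E0 := by
    intro a ha
    by_cases e : a = (i, j, g)
    · exact Or.inl e
    · exact Or.inr (Finset.mem_coe.2 (Finset.mem_erase.2 ⟨e, ha⟩))
  have heE : (i, j, g) ∈ (E : Set (Arc G)) := he
  set d := c * (lm false)⁻¹ with hd
  have hdx : ∀ x, d * x * d⁻¹ ∈ U ↔ Rch (E : Set (Arc G)) i i ((lm false)⁻¹ * x * lm false) := by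
    intro x
    rw [hc]
    have : d * x * d⁻¹ = c * ((lm false)⁻¹ * x * lm false) * c⁻¹ := by rw [hd]; group
    rw [this]
  have hback : ∀ b b' p, Rch E0 (if b then j else i) (if b' then j else i) p →
      d * (lm b * p * (lm b')⁻¹) * d⁻¹ ∈ U := by
    intro b b' p hp
    rw [hdx]
    exact gen_back hlm heE hsub hp
  have hgen : ∀ R : Subgroup G,
      (∀ b b' p, Rch E0 (if b then j else i) (if b' then j else i) p → lm b * p * (lm b')⁻¹ ∈ R) →
      ∀ x, d * x * d⁻¹ ∈ U → x ∈ R := by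
    intro R hRR x hx
    rw [hdx] at hx
    have := gen_mem hlm hEE R hRR hx
    convert this using 1
    group
  let W : Subgroup G := U.comap (MulAut.conj d).toMonoidHom
  have hW : ∀ x, x ∈ W ↔ d * x * d⁻¹ ∈ U := fun x => by simp [W]
  by_cases hsep : ∃ w, Rch E0 j i w
  · obtain ⟨w, hw⟩ := hsep
    set t := lm true * w * (lm false)⁻¹ with ht
    let ω : Bool → G := fun b => if b then 1 else w
    have hω : ∀ b, Rch E0 j (if b then j else i) (ω b) := by
      intro b
      cases b
      · simpa [ω] using hw
      · simpa [ω] using Rch.refl j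
    let κ : Bool → G := fun b => if b then 1 else t
    have hκ : ∀ b, κ b = lm true * ω b * (lm b)⁻¹ := by
      intro b; cases b <;> simp [κ, ω, ht]
    by_cases htriv : ∀ p, Rch E0 j j p → p = 1
    · apply hnc
      have hall := hgen (Subgroup.zpowers t) (by
        intro b b' p hp
        have h1 := htriv _ (((hω b).trans hp).trans (hω b').symm)
        have h2 : lm b * p * (lm b')⁻¹ = (κ b)⁻¹ * (lm true * (ω b * p * (ω b')⁻¹) * (lm true)⁻¹) * κ b' := by
          rw [hκ, hκ]; group
        rw [h2, h1]
        have h3 : ∀ b, κ b ∈ Subgroup.zpowers t := by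
          intro b
          cases b
          · simp [κ]
          · simp [κ]
        have := (Subgroup.zpowers t).mul_mem ((Subgroup.zpowers t).inv_mem (h3 b)) (h3 b')
        simpa using this)
      have hle : U ≤ Subgroup.zpowers (d * t * d⁻¹) := by
        intro u hu
        obtain ⟨n, hn⟩ := hall (d⁻¹ * u * d) (by simpa [mul_assoc] using hu)
        refine ⟨n, ?_⟩
        simp only at hn ⊢
        rw [conj_zpow, hn]; group
      exact Subgroup.isCyclic_of_le hle
    · push Not at htriv
      obtain ⟨p0, hp0, hp1⟩ := htriv
      have : Nontrivial (vgrp E0 j) := ⟨⟨⟨p0, hp0⟩, 1, fun e => hp1 (congrArg Subtype.val e)⟩⟩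
      apply hns
      let f := cj (lm true) (vgrp E0 j)
      let k : Multiplicative ℤ →* G := zpowersHom G t
      let T : Coprod (vgrp E0 j) (Multiplicative ℤ) := Coprod.inr (Multiplicative.ofAdd 1)
      let τ : Bool → Coprod (vgrp E0 j) (Multiplicative ℤ) := fun b => if b then 1 else T
      have hτ : ∀ b, Coprod.lift f k (τ b) = κ b := by
        intro b; cases b
        · simp [τ, κ, T, k]
        · simp [τ, κ]
      have hs : ∀ b b' (a : vgrp E0 j), Coprod.lift f k ((τ b)⁻¹ * Coprod.inl a * τ b') =
          lm b * ((ω b)⁻¹ * a * ω b') * (lm b')⁻¹ := by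
        intro b b' a
        rw [map_mul, map_mul, map_inv, hτ, hτ, Coprod.lift_apply_inl, hκ, hκ]
        simp only [f, cj_apply]
        group
      refine split_contra f k ?_ U d ?_
      · refine inj_of_seg (Coprod.lift f k) (X := X)
          (S := fun b b' x => ∃ a, x = (τ b)⁻¹ * Coprod.inl a * τ b') ?_ hX hne ?_ ?_
        · rintro b b' b'' x y ⟨a, rfl⟩ ⟨a', rfl⟩
          refine ⟨a * a', ?_⟩
          rw [map_mul]; group
        · rintro b b' x ⟨a, rfl⟩ hx
          rw [hs]
          apply hR
          · exact ((hω b).symm.trans a.2).trans (hω b')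
          · rintro rfl h1
            apply hx rfl
            have : (a : G) = 1 := by
              have h2 : (a : G) = ω b * ((ω b)⁻¹ * a * ω b) * (ω b)⁻¹ := by group
              rw [h2, h1]; group
            have : a = 1 := Subtype.ext this
            rw [this, map_one]; group
        · intro C h1 hmul z
          have hz : ∀ n : ℤ, ∀ z, C z → C (T ^ n * z) := by
            intro n
            induction n using Int.induction_on with
            | zero => intro z hz; simpa using hz
            | succ n ih =>
              intro z hz
              rw [zpow_add_one, mul_assoc]
              apply ih
              exact hmul true false T z ⟨1, by simp [τ]⟩ hz
            | pred n ih =>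
              intro z hz
              rw [zpow_sub_one, mul_assoc]
              apply ih
              exact hmul false true T⁻¹ z ⟨1, by simp [τ]⟩ hz
          induction z using Coprod.induction_on' with
          | one => exact h1
          | inl_mul m x ih => exact hmul true true _ x ⟨m, by simp [τ]⟩ ih
          | inr_mul n x ih =>
            have : (Coprod.inr n : Coprod (vgrp E0 j) (Multiplicative ℤ)) = T ^ (Multiplicative.toAdd n) := by
              simp only [T]
              rw [← map_zpow, ← ofAdd_zsmul]
              simp
            rw [this]
            exact hz _ _ ih
      · intro x
        constructor
        · rw [← hW]
          intro hx
          have : (Coprod.lift f k).range ≤ W := by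
            rw [Coprod.range_lift]
            refine sup_le ?_ ?_
            · rintro _ ⟨a, rfl⟩
              rw [hW]
              exact hback true true a (by simpa using mem_vgrp.1 a.2)
            · rintro _ ⟨n, rfl⟩
              have htW : t ∈ W := (hW _).2 (hback true false w (by simpa using hw))
              simp only [k, zpowersHom_apply]
              exact W.zpow_mem htW _
          exact this hx
        · apply hgen
          intro b b' p hp
          have hm := ((hω b).trans hp).trans (hω b').symm
          refine ⟨(τ b)⁻¹ * Coprod.inl ⟨_, hm⟩ * τ b', ?_⟩
          rw [hs]
          group
  · push Not at hsep
    have ht1 : ∃ p, Rch E0 i i p ∧ p ≠ 1 := by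
      by_contra hcon
      push Not at hcon
      exact triv_contra H h he (by omega) hsep (Or.inl hcon)
    have ht2 : ∃ p, Rch E0 j j p ∧ p ≠ 1 := by
      by_contra hcon
      push Not at hcon
      exact triv_contra H h he (by omega) hsep (Or.inr hcon)
    obtain ⟨p0, hp0, hp1⟩ := ht1
    obtain ⟨q0, hq0, hq1⟩ := ht2
    have : Nontrivial (vgrp E0 i) := ⟨⟨⟨p0, hp0⟩, 1, fun e => hp1 (congrArg Subtype.val e)⟩⟩
    have : Nontrivial (vgrp E0 j) := ⟨⟨⟨q0, hq0⟩, 1, fun e => hq1 (congrArg Subtype.val e)⟩⟩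
    apply hns
    let f := cj (lm false) (vgrp E0 i)
    let k := cj (lm true) (vgrp E0 j)
    refine split_contra f k ?_ U d ?_
    · refine inj_of_seg (Coprod.lift f k) (X := X)
          (S := fun b b' x => (b = false ∧ b' = false ∧ ∃ a, x = Coprod.inl a) ∨
            (b = true ∧ b' = true ∧ ∃ a, x = Coprod.inr a)) ?_ hX hne ?_ ?_
      · rintro b b' b'' x y (⟨rfl, rfl, a, rfl⟩ | ⟨rfl, rfl, a, rfl⟩) (⟨h1, rfl, a', rfl⟩ | ⟨h1, rfl, a', rfl⟩)
        · exact Or.inl ⟨rfl, rfl, a * a', by rw [map_mul]⟩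
        · exact absurd h1 (by simp)
        · exact absurd h1 (by simp)
        · exact Or.inr ⟨rfl, rfl, a * a', by rw [map_mul]⟩
      · rintro b b' x (⟨rfl, rfl, a, rfl⟩ | ⟨rfl, rfl, a, rfl⟩) hx
        · rw [Coprod.lift_apply_inl]
          refine hR false a false (by simpa using mem_vgrp.1 a.2) fun _ e => hx rfl ?_
          rw [show a = 1 from Subtype.ext e, map_one]
        · rw [Coprod.lift_apply_inr]
          refine hR true a true (by simpa using mem_vgrp.1 a.2) fun _ e => hx rfl ?_
          rw [show a = 1 from Subtype.ext e, map_one]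
      · intro C h1 hmul z
        induction z using Coprod.induction_on' with
        | one => exact h1
        | inl_mul m x ih => exact hmul false false _ x (Or.inl ⟨rfl, rfl, m, rfl⟩) ih
        | inr_mul m x ih => exact hmul true true _ x (Or.inr ⟨rfl, rfl, m, rfl⟩) ih
    · intro x
      constructor
      · rw [← hW]
        intro hx
        have : (Coprod.lift f k).range ≤ W := by
          rw [Coprod.range_lift]
          refine sup_le ?_ ?_
          · rintro _ ⟨a, rfl⟩
            rw [hW]
            exact hback false false a (by simpa using mem_vgrp.1 a.2)
          · rintro _ ⟨a, rfl⟩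
            rw [hW]
            exact hback true true a (by simpa using mem_vgrp.1 a.2)
        exact this hx
      · apply hgen
        intro b b' p hp
        cases b <;> cases b'
        · exact ⟨Coprod.inl ⟨p, by simpa [mem_vgrp] using hp⟩, rfl⟩
        · exact (hsep _ (by simpa using hp.symm)).elim
        · exact (hsep _ (by simpa using hp)).elim
        · exact ⟨Coprod.inr ⟨p, by simpa [mem_vgrp] using hp⟩, rfl⟩

end NoLong
end KWP

namespace KWP

noncomputable section Main

open Classical

variable {G : Type*} [Group G] {len : G → ℕ} {D : ℕ}

theorem gap (ρ : ℕ → ℕ) (hρ : Monotone ρ) {A : Type*} (E : Finset A) (f : A → ℕ) (k : ℕ) (hk : E.card ≤ k) :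
    ∃ n ≤ k, ∀ a ∈ E, ρ n < f a → ρ (n + 1) ≤ f a := by
  by_contra hcon
  push Not at hcon
  have h : ∀ n : ℕ, ∃ a, n ≤ k → a ∈ E ∧ ρ n < f a ∧ f a < ρ (n + 1) := by
    intro n
    by_cases hn : n ≤ k
    · obtain ⟨a, h1, h2, h3⟩ := hcon n hn
      exact ⟨a, fun _ => ⟨h1, h2, h3⟩⟩
    · obtain ⟨a, _⟩ := hcon 0 (Nat.zero_le _)
      exact ⟨a, fun h => absurd h hn⟩
  choose a ha using h
  obtain ⟨x, hx, y, hy, hxy, e⟩ := Finset.exists_ne_map_eq_of_card_lt_of_maps_to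
    (s := Finset.range (k + 1)) (t := E) (by simp; omega) (f := a) (by
      intro n hn
      have : n < k + 1 := by simpa using hn
      exact (ha n (by omega)).1)
  have hx' : x ≤ k := by simp at hx; omega
  have hy' : y ≤ k := by simp at hy; omega
  have key : ∀ x y, x ≤ k → y ≤ k → x < y → a x = a y → False := by
    intro x y hx hy hlt e
    have h1 := (ha x hx).2.2
    have h2 := (ha y hy).2.1
    have h3 := hρ (show x + 1 ≤ y from hlt)
    rw [e] at h1
    omega
  rcases lt_or_gt_of_ne hxy with h | h
  · exact key _ _ hx' hy' h e
  · exact key _ _ hy' hx' h e.symm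

theorem main (H : HypLen len D)
    (hATF : ∀ g : G, g ≠ 1 → IsOfFinOrder g →
      ((Subgroup.centralizer {g} : Subgroup G) : Set G).Finite)
    (hQC : ∀ T : Finset G, ∃ ε, QC len ε (Subgroup.closure (T : Set G))) (l : ℕ) (hl : 1 ≤ l) :
    ∃ M, ∀ U : Subgroup G, (∃ T : Finset G, T.card ≤ l ∧ Subgroup.closure (T : Set G) = U) →
      (¬ ∃ A B : Subgroup U, A ≠ ⊥ ∧ B ≠ ⊥ ∧
        Function.Bijective (Monoid.Coprod.lift A.subtype B.subtype)) →
      ¬ IsCyclic U →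
      ∃ S : Set G, (∀ s ∈ S, len s ≤ M) ∧ ∃ c, ∀ g, g ∈ Subgroup.closure S ↔ c * g * c⁻¹ ∈ U := by
  have hB : ∀ r : ℕ, ∃ B, ∀ S : Set G, (∀ s ∈ S, len s ≤ 2 * (r * (2 * l)) + r) →
      Good len (9 * D) B (Subgroup.closure S) := fun r => unif H hATF hQC _ _
  choose B hB using hB
  let ρ : ℕ → ℕ := fun n => Nat.rec 0 (fun _ r => max (r + 1) (2 * (8 * D + B r + r * (2 * l) + 3))) n
  have hρs : ∀ n, ρ (n + 1) = max (ρ n + 1) (2 * (8 * D + B (ρ n) + ρ n * (2 * l) + 3)) := fun _ => rfl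
  have hρ : Monotone ρ := monotone_nat_of_le_succ fun n => by rw [hρs]; omega
  refine ⟨2 * (ρ (3 * l) * (2 * l)) + ρ (3 * l), fun U ⟨T, hT, hTU⟩ hns hnc => ?_⟩
  obtain ⟨V, E, h⟩ := exists_min (len := len) U l T hT hTU
  obtain ⟨hVc, hEc⟩ := h.min_card H hl
  obtain ⟨n, hn, hgap⟩ := gap ρ hρ E (fun a => len a.2.2) _ hEc
  have hF : ∀ a ∈ sh len (ρ n) E, len a.2.2 ≤ ρ n := fun a ha => (mem_sh.1 ha).2
  have hV : ∀ a ∈ sh len (ρ n) E, a.1 ∈ V ∧ a.2.1 ∈ V := fun a ha => h.1.ends _ (mem_sh.1 ha).1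
  have hmul : ρ n * V.card ≤ ρ n * (2 * l) := Nat.mul_le_mul_left _ hVc
  have hmul2 : ρ n * (2 * l) ≤ ρ (3 * l) * (2 * l) := Nat.mul_le_mul_right _ (hρ hn)
  have hmn := hρ hn
  have hshort : ∀ a ∈ E, len a.2.2 ≤ ρ n := by
    by_contra hcon
    push Not at hcon
    obtain ⟨⟨i, j, g⟩, he, hlen⟩ := hcon
    refine no_long H h (r := ρ n) (B := B (ρ n)) (D1 := ρ n * (2 * l)) ?_ ?_ ?_ hns hnc he hlen
    · intro v hv
      obtain ⟨S, hS, hS'⟩ := vgrp_gen H hF hV hv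
      rw [hS']
      exact hB _ S fun s hs => by have := hS s hs; omega
    · intro i hi j g hg
      obtain ⟨c, hc, hc'⟩ := short_path H hF hV hi hg
      exact ⟨c, hc, hc'.trans hmul⟩
    · intro a ha hla
      have h1 := hgap a ha hla
      rw [hρs] at h1
      exact (le_max_right _ _).trans h1
  obtain ⟨v, hv, c, hc⟩ := h.1.grp
  obtain ⟨S, hS, hS'⟩ := vgrp_gen H hshort h.1.ends hv
  refine ⟨S, fun s hs => by have := hS s hs; omega, c, fun g => ?_⟩
  rw [← hS', mem_vgrp, hc]

theorem main2 (H : HypLen len D)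
    (hATF : ∀ g : G, g ≠ 1 → IsOfFinOrder g →
      ((Subgroup.centralizer {g} : Subgroup G) : Set G).Finite)
    (hQC : ∀ T : Finset G, ∃ ε, QC len ε (Subgroup.closure (T : Set G))) (l : ℕ) (hl : 1 ≤ l) :
    ∃ (N : ℕ) (Hs : Fin N → Subgroup G),
     ∀ U : Subgroup G, (∃ T : Finset G, T.card ≤ l ∧ Subgroup.closure (T : Set G) = U) →
      (¬ ∃ A B : Subgroup U, A ≠ ⊥ ∧ B ≠ ⊥ ∧
        Function.Bijective (Monoid.Coprod.lift A.subtype B.subtype)) →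
      ¬ IsCyclic U →
      ∃ (i : Fin N) (g : G), Subgroup.map (MulAut.conj g).toMonoidHom (Hs i) = U := by
  obtain ⟨M, hM⟩ := main H hATF hQC l hl
  have hfin : {K : Subgroup G | ∃ S : Set G, (∀ s ∈ S, len s ≤ M) ∧ K = Subgroup.closure S}.Finite := by
    refine (((H.ball M).powerset).image Subgroup.closure).subset ?_
    rintro K ⟨S, hS, rfl⟩
    exact ⟨S, fun s hs => hS s hs, rfl⟩
  let F := hfin.toFinset
  refine ⟨F.card, fun i => (F.equivFin.symm i : Subgroup G), fun U hT hns hnc => ?_⟩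
  obtain ⟨S, hS, c, hc⟩ := hM U hT hns hnc
  have hmem : Subgroup.closure S ∈ F := by
    rw [Set.Finite.mem_toFinset]
    exact ⟨S, hS, rfl⟩
  refine ⟨F.equivFin ⟨_, hmem⟩, c, ?_⟩
  simp only [Equiv.symm_apply_apply]
  ext u
  simp only [Subgroup.mem_map]
  constructor
  · rintro ⟨x, hx, rfl⟩
    exact (hc x).1 hx
  · intro hu
    refine ⟨c⁻¹ * u * c, (hc _).2 (by simpa [mul_assoc] using hu), by simp [mul_assoc]⟩

end Main
end KWP

namespace KWP

noncomputable section Geom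

open KW

section Len

variable {G : Type*} [Group G] {S : Set G}

theorem wl_le {g : G} (L : List G) (h : ∀ x ∈ L, x ∈ S ∨ x⁻¹ ∈ S) (e : L.prod = g) :
    wordLength S g ≤ L.length := by
  refine Nat.sInf_le ⟨fun i => L.get i, fun i => h _ (List.get_mem _ _), ?_⟩
  rw [List.ofFn_get, e]

theorem wl_fn (hS : Subgroup.closure S = ⊤) (g : G) :
    ∃ f : Fin (wordLength S g) → G, (∀ i, f i ∈ S ∨ (f i)⁻¹ ∈ S) ∧ (List.ofFn f).prod = g := by
  have hne : {n : ℕ | ∃ f : Fin n → G, (∀ i, f i ∈ S ∨ (f i)⁻¹ ∈ S) ∧ (List.ofFn f).prod = g}.Nonempty := by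
    obtain ⟨L, hL, e⟩ : ∃ L : List G, (∀ x ∈ L, x ∈ S ∨ x⁻¹ ∈ S) ∧ L.prod = g := by
      have hg : g ∈ Submonoid.closure (S ∪ S⁻¹) := by
        rw [← Subgroup.closure_toSubmonoid, hS]; trivial
      obtain ⟨L, h1, h2⟩ := Submonoid.exists_list_of_mem_closure hg
      exact ⟨L, fun x hx => by simpa using h1 x hx, h2⟩
    exact ⟨L.length, fun i => L.get i, fun i => hL _ (List.get_mem _ _), by rw [List.ofFn_get, e]⟩
  exact Nat.sInf_mem hne

theorem wl_list (hS : Subgroup.closure S = ⊤) (g : G) :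
    ∃ L : List G, L.length = wordLength S g ∧ (∀ x ∈ L, x ∈ S ∨ x⁻¹ ∈ S) ∧ L.prod = g := by
  obtain ⟨f, h1, h2⟩ := wl_fn hS g
  refine ⟨List.ofFn f, by simp, ?_, h2⟩
  intro x hx
  obtain ⟨i, rfl⟩ := (List.mem_ofFn' f x).1 hx
  exact h1 i

theorem wl_mul (hS : Subgroup.closure S = ⊤) (g h : G) :
    wordLength S (g * h) ≤ wordLength S g + wordLength S h := by
  obtain ⟨L, l1, l2, l3⟩ := wl_list hS g
  obtain ⟨M, m1, m2, m3⟩ := wl_list hS h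
  rw [← l1, ← m1, ← List.length_append]
  refine wl_le _ ?_ (by rw [List.prod_append, l3, m3])
  intro x hx
  rcases List.mem_append.1 hx with hx | hx
  · exact l2 x hx
  · exact m2 x hx

theorem wl_inv_le (hS : Subgroup.closure S = ⊤) (g : G) : wordLength S g⁻¹ ≤ wordLength S g := by
  obtain ⟨L, l1, l2, l3⟩ := wl_list hS g
  have := wl_le (S := S) (g := g⁻¹) (L.map (·⁻¹)).reverse (by
    intro x hx
    simp only [List.mem_reverse, List.mem_map] at hx
    obtain ⟨y, hy, rfl⟩ := hx
    rw [inv_inv]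
    exact (l2 y hy).symm) (by rw [← List.prod_inv_reverse, l3])
  simpa [l1] using this

theorem wl_split (hS : Subgroup.closure S = ⊤) (g : G) (t : ℕ) (ht : t ≤ wordLength S g) :
    ∃ a b, a * b = g ∧ wordLength S a = t ∧ wordLength S b + t = wordLength S g := by
  obtain ⟨L, l1, l2, l3⟩ := wl_list hS g
  have h1 := wl_le (S := S) (L.take t) (fun x hx => l2 x (List.mem_of_mem_take hx)) rfl
  have h2 := wl_le (S := S) (L.drop t) (fun x hx => l2 x (List.mem_of_mem_drop hx)) rfl
  have e : (L.take t).prod * (L.drop t).prod = g := by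
    rw [← List.prod_append, List.take_append_drop, l3]
  have h3 := wl_mul hS (L.take t).prod (L.drop t).prod
  rw [e] at h3
  rw [List.length_take] at h1
  rw [List.length_drop] at h2
  refine ⟨_, _, e, ?_, ?_⟩ <;> omega

theorem wl_ball (hS : Subgroup.closure S = ⊤) (hf : S.Finite) (n : ℕ) : {g | wordLength S g ≤ n}.Finite := by
  have hA : {x : G | x ∈ S ∨ x⁻¹ ∈ S}.Finite := hf.union (hf.preimage inv_injective.injOn)
  have h1 : ∀ k : ℕ, {g : G | ∃ f : Fin k → G, (∀ i, f i ∈ S ∨ (f i)⁻¹ ∈ S) ∧ (List.ofFn f).prod = g}.Finite := by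
    intro k
    have h2 := Set.Finite.pi' (ι := Fin k) (fun _ => hA)
    refine (h2.image (fun f => (List.ofFn f).prod)).subset ?_
    rintro g ⟨f, hf, rfl⟩
    exact ⟨f, hf, rfl⟩
  refine (Set.Finite.biUnion (Set.finite_Iic n) (fun k _ => h1 k)).subset ?_
  intro g hg
  exact Set.mem_biUnion (show wordLength S g ∈ Set.Iic n from hg) (wl_fn hS g)

theorem wl_one : wordLength S (1 : G) = 0 :=
  Nat.le_zero.1 (wl_le (S := S) [] (by simp) (by simp))

theorem wl_eq_one (hS : Subgroup.closure S = ⊤) (g : G) (h : wordLength S g = 0) : g = 1 := by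
  obtain ⟨L, l1, l2, l3⟩ := wl_list hS g
  rw [h, List.length_eq_zero_iff] at l1
  rw [← l3, l1, List.prod_nil]

end Len

section Hyp

variable {X : Type*} [MetricSpace X]

theorem seg_add {s : Set X} {x y q : X} (h : IsGeodesicSegment s x y) (hq : q ∈ s) :
    dist x q + dist q y = dist x y := by
  obtain ⟨b, f, hb, rfl, rfl, hd, rfl⟩ := h
  obtain ⟨t, ht, rfl⟩ := hq
  rw [hd 0 ⟨le_rfl, hb⟩ t ht, hd t ht b ⟨hb, le_rfl⟩, hd 0 ⟨le_rfl, hb⟩ b ⟨hb, le_rfl⟩]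
  rw [abs_of_nonpos (by linarith [ht.1]), abs_of_nonpos (by linarith [ht.2]), abs_of_nonpos (by linarith)]
  ring

theorem seg_near {s : Set X} {x y q p : X} {c : ℝ} (h : IsGeodesicSegment s x y) (hq : q ∈ s)
    (hp : dist p q ≤ c) : dist x p + dist p y ≤ dist x y + 2 * c := by
  have h1 := seg_add h hq
  have h2 := dist_triangle x q p
  have h3 := dist_triangle p q y
  rw [dist_comm q p] at h2
  linarith

theorem tripod {δ : ℝ} (hδ : 0 ≤ δ) (hX : DeltaHyperbolic δ X) {x z : X} (b : ℝ) (f : ℝ → X) (hb : 0 ≤ b)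
    (h0 : f 0 = x) (h1 : f b = z)
    (hd : ∀ u ∈ Set.Icc (0 : ℝ) b, ∀ v ∈ Set.Icc (0 : ℝ) b, dist (f u) (f v) = |u - v|) (y : X) :
    ∃ t ∈ Set.Icc (0 : ℝ) b, dist x (f t) + dist (f t) y ≤ dist x y + 2 * (δ + 1) ∧
      dist z (f t) + dist (f t) y ≤ dist z y + 2 * (δ + 1) := by
  obtain ⟨s2, hs2⟩ := hX.1 z y
  obtain ⟨s3, hs3⟩ := hX.1 x y
  have hs1 : IsGeodesicSegment (f '' Set.Icc 0 b) x z := ⟨b, f, hb, h0, h1, hd, rfl⟩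
  have hthin := hX.2 x z y _ s2 s3 hs1 hs2 hs3
  let A : Set ℝ := {t | t ∈ Set.Icc (0 : ℝ) b ∧ ∃ q ∈ s3, dist (f t) q ≤ δ}
  have hx3 : x ∈ s3 := by
    obtain ⟨b', f', hb', h0', _, _, rfl⟩ := hs3
    exact ⟨0, ⟨le_rfl, hb'⟩, h0'⟩
  have hz2 : z ∈ s2 := by
    obtain ⟨b', f', hb', h0', _, _, rfl⟩ := hs2
    exact ⟨0, ⟨le_rfl, hb'⟩, h0'⟩
  have hA0 : (0 : ℝ) ∈ A := ⟨⟨le_rfl, hb⟩, x, hx3, by rw [h0, dist_self]; exact hδ⟩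
  have hAb : BddAbove A := ⟨b, fun t ht => ht.1.2⟩
  obtain ⟨t1, ht1, hlt⟩ := exists_lt_of_lt_csSup ⟨0, hA0⟩ (show sSup A - 1 < sSup A by linarith)
  obtain ⟨q, hq, hdq⟩ := ht1.2
  refine ⟨t1, ht1.1, (seg_near hs3 hq hdq).trans (by linarith), ?_⟩
  have : ∃ q ∈ s2, dist (f t1) q ≤ δ + 1 := by
    by_cases hcase : t1 + 1 ≤ b
    · have hm : t1 + 1 ∈ Set.Icc (0 : ℝ) b := ⟨by linarith [ht1.1.1], hcase⟩
      obtain ⟨q', hq', hd'⟩ := hthin (f (t1 + 1)) ⟨_, hm, rfl⟩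
      rcases hq' with hq' | hq'
      · refine ⟨q', hq', ?_⟩
        have h3 := dist_triangle (f t1) (f (t1 + 1)) q'
        rw [hd _ ht1.1 _ hm] at h3
        have : |t1 - (t1 + 1)| = 1 := by rw [sub_add_cancel_left]; simp
        linarith
      · have := le_csSup hAb (show t1 + 1 ∈ A from ⟨hm, q', hq', hd'⟩)
        linarith
    · refine ⟨z, hz2, ?_⟩
      rw [← h1, hd _ ht1.1 _ ⟨hb, le_rfl⟩, abs_of_nonpos (by linarith [ht1.1.2])]
      push Not at hcase
      linarith
  obtain ⟨q', hq', hd'⟩ := this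
  exact seg_near hs2 hq' hd'

theorem four_pt {δ : ℝ} (hδ : 0 ≤ δ) (hX : DeltaHyperbolic δ X) (x y z w : X) :
    dist x z + dist y w ≤ dist x y + dist z w + 4 * (δ + 1) ∨
    dist x z + dist y w ≤ dist x w + dist y z + 4 * (δ + 1) := by
  obtain ⟨s, b, f, hb, h0, h1, hd, _⟩ := hX.1 x z
  obtain ⟨t, ht, a1, a2⟩ := tripod hδ hX b f hb h0 h1 hd y
  obtain ⟨u, hu, b1, b2⟩ := tripod hδ hX b f hb h0 h1 hd w
  have e0 : dist x z = b := by
    rw [← h0, ← h1, hd 0 ⟨le_rfl, hb⟩ b ⟨hb, le_rfl⟩, abs_of_nonpos (by linarith)]; ring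
  have ex : ∀ t ∈ Set.Icc (0 : ℝ) b, dist x (f t) = t := by
    intro t ht
    rw [← h0, hd 0 ⟨le_rfl, hb⟩ t ht, abs_of_nonpos (by linarith [ht.1])]; ring
  have ez : ∀ t ∈ Set.Icc (0 : ℝ) b, dist z (f t) = b - t := by
    intro t ht
    rw [← h1, hd b ⟨hb, le_rfl⟩ t ht, abs_of_nonneg (by linarith [ht.2])]
  rw [ex t ht] at a1
  rw [ez t ht] at a2
  rw [ex u hu] at b1
  rw [ez u hu] at b2
  have k1 := dist_triangle y (f t) w
  have k2 := dist_triangle (f t) (f u) w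
  rw [dist_comm y (f t)] at k1
  rw [hd t ht u hu] at k2
  rw [e0, dist_comm y z]
  rcases le_total t u with h | h
  · right
    rw [abs_of_nonpos (by linarith)] at k2
    linarith
  · left
    rw [abs_of_nonneg (by linarith)] at k2
    linarith

theorem seg_through (hX : GeodesicSpace X) {x p y : X} (h : dist x p + dist p y = dist x y) :
    ∃ s, IsGeodesicSegment s x y ∧ p ∈ s := by
  obtain ⟨s1, a, f, ha, f0, fa, fd, _⟩ := hX x p
  obtain ⟨s2, b, k, hb, k0, kb, kd, _⟩ := hX p y
  have exp : dist x p = a := by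
    rw [← f0, ← fa, fd 0 ⟨le_rfl, ha⟩ a ⟨ha, le_rfl⟩, abs_of_nonpos (by linarith)]; ring
  have epy : dist p y = b := by
    rw [← k0, ← kb, kd 0 ⟨le_rfl, hb⟩ b ⟨hb, le_rfl⟩, abs_of_nonpos (by linarith)]; ring
  let F : ℝ → X := fun t => if t ≤ a then f t else k (t - a)
  have hmix : ∀ u ∈ Set.Icc (0 : ℝ) (a + b), ∀ v ∈ Set.Icc (0 : ℝ) (a + b), u ≤ a → ¬ v ≤ a →
      dist (f u) (k (v - a)) = v - u := by
    intro u hu v hv hua hva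
    push Not at hva
    have hu' : u ∈ Set.Icc (0 : ℝ) a := ⟨hu.1, hua⟩
    have hv' : v - a ∈ Set.Icc (0 : ℝ) b := ⟨by linarith, by linarith [hv.2]⟩
    have d1 : dist x (f u) = u := by
      rw [← f0, fd 0 ⟨le_rfl, ha⟩ u hu', abs_of_nonpos (by linarith [hu'.1])]; ring
    have d2 : dist (f u) p = a - u := by
      rw [← fa, fd u hu' a ⟨ha, le_rfl⟩, abs_of_nonpos (by linarith)]; ring
    have d3 : dist p (k (v - a)) = v - a := by
      rw [← k0, kd 0 ⟨le_rfl, hb⟩ _ hv', abs_of_nonpos (by linarith)]; ring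
    have d4 : dist (k (v - a)) y = a + b - v := by
      rw [← kb, kd _ hv' b ⟨hb, le_rfl⟩, abs_of_nonpos (by linarith [hv.2])]; ring
    have t1 := dist_triangle (f u) p (k (v - a))
    have t2 := dist_triangle x (f u) y
    have t3 := dist_triangle (f u) (k (v - a)) y
    linarith
  refine ⟨F '' Set.Icc 0 (a + b), ⟨a + b, F, by linarith, ?_, ?_, ?_, rfl⟩, ⟨a, ⟨ha, by linarith⟩, ?_⟩⟩
  · simp [F, ha, f0]
  · by_cases hb0 : a + b ≤ a
    · have : b = 0 := by linarith
      subst this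
      simp only [F, add_zero, le_refl, if_true]
      rw [fa, ← k0, kb]
    · simp only [F, if_neg hb0, add_sub_cancel_left, kb]
  · intro u hu v hv
    by_cases hua : u ≤ a <;> by_cases hva : v ≤ a <;> simp only [F, if_pos, if_neg, hua, hva, not_false_eq_true]
    · exact fd u ⟨hu.1, hua⟩ v ⟨hv.1, hva⟩
    · rw [hmix u hu v hv hua hva, abs_of_nonpos (by linarith)]; ring
    · rw [dist_comm, hmix v hv u hu hva hua, abs_of_nonneg (by linarith)]
    · push Not at hua hva
      rw [kd _ ⟨by linarith, by linarith [hu.2]⟩ _ ⟨by linarith, by linarith [hv.2]⟩]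
      congr 1; ring
  · simp [F, fa]

variable {G : Type*} [Group G]

theorem hypLen_wl {S : Set G} (hS : Subgroup.closure S = ⊤) (hf : S.Finite) {ι : G → X}
    (hι : ∀ g h : G, dist (ι g) (ι h) = (wordLength S (g⁻¹ * h) : ℝ)) {δ : ℝ} (hδ : 0 ≤ δ)
    (hX : DeltaHyperbolic δ X) : HypLen (wordLength S) ⌈4 * (δ + 1)⌉₊ where
  one := wl_one
  inv g := le_antisymm (wl_inv_le hS g) (by simpa using wl_inv_le hS g⁻¹)
  mul := wl_mul hS
  eq_one := wl_eq_one hS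
  ball := wl_ball hS hf
  split := wl_split hS
  four x y z w := by
    have hc : 4 * (δ + 1) ≤ (⌈4 * (δ + 1)⌉₊ : ℝ) := Nat.le_ceil _
    have := four_pt hδ hX (ι x) (ι y) (ι z) (ι w)
    simp only [hι] at this
    rcases this with h | h
    · left
      have h' := h.trans (add_le_add_right hc _)
      exact_mod_cast h'
    · right
      have h' := h.trans (add_le_add_right hc _)
      exact_mod_cast h'

theorem qc_wl {S : Set G} {ι : G → X}
    (hι : ∀ g h : G, dist (ι g) (ι h) = (wordLength S (g⁻¹ * h) : ℝ)) (hX : GeodesicSpace X)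
    {K : Subgroup G} (hK : QCSubgroup X ι K) : ∃ ε, QC (wordLength S) ε K := by
  obtain ⟨ε, _, hq⟩ := hK
  refine ⟨⌈ε⌉₊, fun x hx p hp => ?_⟩
  have hd : dist (ι 1) (ι p) + dist (ι p) (ι x) = dist (ι 1) (ι x) := by
    simp only [hι]
    exact_mod_cast hp
  obtain ⟨s, hs, hps⟩ := seg_through hX hd
  obtain ⟨_, ⟨k, hk, rfl⟩, hle⟩ := hq (ι 1) ⟨1, K.one_mem, rfl⟩ (ι x) ⟨x, hx, rfl⟩ s hs _ hps
  refine ⟨k, hk, ?_⟩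
  rw [hι] at hle
  have := hle.trans (Nat.le_ceil ε)
  exact_mod_cast this

end Hyp

end Geom
end KWP

universe u

namespace KW

open Pointwise Metric Set

theorem statement2 {G : Type u} [Group G] (hATF : AlmostTorsionFree G)
    (hyp : ∃ (S : Finset G) (X : Type u) (iX : MetricSpace X) (aX : MulAction G X)
        (ι : G → X) (δ : ℝ), 0 ≤ δ ∧
        Subgroup.closure (S : Set G) = ⊤ ∧
        @IsCayleyGraph G inferInstance (S : Set G) X iX aX ι ∧
        @DeltaHyperbolic δ X iX ∧
        ∀ H : Subgroup G, (∃ T : Finset G, Subgroup.closure (T : Set G) = H) →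
          @QCSubgroup G inferInstance X iX ι H) :
    ∀ l : ℕ, 1 ≤ l →
      ∃ (N : ℕ) (Hs : Fin N → Subgroup G),
        ∀ U : Subgroup G,
          (∃ T : Finset G, T.card ≤ l ∧ Subgroup.closure (T : Set G) = U) →
          NonElementary ↥U → FreelyIndecomposable ↥U →
          ∃ (i : Fin N) (g : G), Subgroup.map (MulAut.conj g).toMonoidHom (Hs i) = U := by
  intro l hl
  obtain ⟨S, X, iX, aX, ι, δ, hδ, hS, hC, hX, hQ⟩ := hyp
  obtain ⟨_, _, _, hgeo, hdist, _⟩ := hC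
  have H := KWP.hypLen_wl hS S.finite_toSet hdist hδ hX
  obtain ⟨N, Hs, h⟩ := KWP.main2 H hATF
    (fun T => KWP.qc_wl hdist hgeo (hQ _ ⟨T, rfl⟩)) l hl
  refine ⟨N, Hs, fun U hU hne hfi => h U hU hfi.2 fun hc => hne.2 ?_⟩
  refine ⟨⊤, by simp, ?_⟩
  exact Subgroup.topEquiv.symm.isCyclic.1 hc

end KW
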